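/- arXiv:0901.4324 — 2 statements merged into one kernel-verified Lean document; each statement's English description precedes it below -/
import Mathlib

section
/- Let N ≥ 1 and let f be continuous satisfying (P) and (KO). Let u₁, u₂ : (r₀,1) → ℝ be two strictly increasing C² solutions of u''(r) + ((N−1)/r)·u'(r) = f(u(r)) on (r₀,1) with u_i(r) → +∞ as r → 1⁻, and define g_i(r) = F(u_i(r)) − u_i'(r)²/2 for i = 1,2. Then the difference of g₁ and g₂, compared at equal heights, is bounded: there exist C > 0 and T ∈ ℝ such that whenever r₁, r₂ ∈ (r₀,1) satisfy u₁(r₁) = u₂(r₂) ≥ T, one has |g₁(r₁) − g₂(r₂)| ≤ C. -/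
open MeasureTheory Filter Metric Set

theorem monotoneOn_Ici_of_hasDerivAt_nonneg {φ φ' : ℝ → ℝ} {s : ℝ}
    (h : ∀ t, s ≤ t → HasDerivAt φ (φ' t) t) (h' : ∀ t, s ≤ t → 0 ≤ φ' t) :
    MonotoneOn φ (Ici s) := by
  refine monotoneOn_of_hasDerivWithinAt_nonneg (convex_Ici s) (f' := φ')
    (fun t ht => (h t ht).continuousAt.continuousWithinAt) ?_ ?_ <;>
  · intro t ht
    rw [interior_Ici] at ht
    first
    | exact h' t (le_of_lt ht)
    | exact (h t (le_of_lt ht)).hasDerivWithinAt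

theorem nonpos_of_hasDerivAt_nonneg_of_tendsto_zero {φ φ' : ℝ → ℝ} {s : ℝ}
    (h : ∀ t, s ≤ t → HasDerivAt φ (φ' t) t) (h' : ∀ t, s ≤ t → 0 ≤ φ' t)
    (hlim : Tendsto φ atTop (nhds 0)) : φ s ≤ 0 := by
  refine ge_of_tendsto hlim ?_
  filter_upwards [eventually_ge_atTop s] with t ht
  exact monotoneOn_Ici_of_hasDerivAt_nonneg h h' self_mem_Ici ht ht

/-- A positive nondecreasing function `F` on `[M, ∞)` tending to infinity, together with a
function `Φ` representing the convergent tail integral `∫_t^∞ 1 / √F`. -/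
structure KellerOssermanTail (F Φ : ℝ → ℝ) (M : ℝ) : Prop where
  continuous : Continuous F
  pos : ∀ t, M ≤ t → 0 < F t
  mono : MonotoneOn F (Ici M)
  tendsto : Tendsto F atTop atTop
  hasDerivAt : ∀ t, M ≤ t → HasDerivAt Φ (-(1 / √(F t))) t
  tendsto_tail : Tendsto Φ atTop (nhds 0)

namespace KellerOssermanTail

variable {F Φ : ℝ → ℝ} {M : ℝ}

theorem tail_nonneg (H : KellerOssermanTail F Φ M) {t : ℝ} (ht : M ≤ t) : 0 ≤ Φ t := by
  have := nonpos_of_hasDerivAt_nonneg_of_tendsto_zero (φ := fun t => -Φ t)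
    (φ' := fun t => -(-(1 / √(F t)))) (s := t) (fun x hx => (H.hasDerivAt x (ht.trans hx)).neg)
    (fun x _ => by simp) (by simpa using H.tendsto_tail.neg)
  simpa using this

theorem tail_antitone (H : KellerOssermanTail F Φ M) {s t : ℝ} (hs : M ≤ s) (hst : s ≤ t) :
    Φ t ≤ Φ s := by
  have := monotoneOn_Ici_of_hasDerivAt_nonneg (φ := fun t => -Φ t)
    (φ' := fun t => -(-(1 / √(F t)))) (s := s) (fun x hx => (H.hasDerivAt x (hs.trans hx)).neg)
    (fun x _ => by simp) self_mem_Ici hst hst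
  simpa using this

theorem hasDerivAt_integral_sqrt (hF : Continuous F) (T t : ℝ) :
    HasDerivAt (fun t => ∫ s in T..t, √(F s)) (√(F t)) t :=
  (hF.sqrt.integral_hasStrictDerivAt T t).hasDerivAt

theorem integral_sqrt_nonneg {T t : ℝ} (h : T ≤ t) : 0 ≤ ∫ s in T..t, √(F s) :=
  intervalIntegral.integral_nonneg h fun _ _ => Real.sqrt_nonneg _

theorem integral_sqrt_le (H : KellerOssermanTail F Φ M) {T t : ℝ} (hT : M ≤ T) (ht : T ≤ t) :
    ∫ s in T..t, √(F s) ≤ F t * Φ T := by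
  have key := antitoneOn_of_hasDerivWithinAt_nonpos (convex_Icc T t)
    (f := fun x => (∫ s in T..x, √(F s)) + F t * Φ x)
    (f' := fun x => √(F x) + F t * (-(1 / √(F x))))
    (fun x hx => ((hasDerivAt_integral_sqrt H.continuous T x).add
      ((H.hasDerivAt x (hT.trans hx.1)).const_mul _)).continuousAt.continuousWithinAt)
    (fun x hx => ((hasDerivAt_integral_sqrt H.continuous T x).add
      ((H.hasDerivAt x (hT.trans (interior_subset hx).1)).const_mul _)).hasDerivWithinAt)
    (fun x hx => by
      have hx := interior_subset hx
      have hp := H.pos x (hT.trans hx.1)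
      have hm := H.mono (hT.trans hx.1) (hT.trans ht) hx.2
      have h0 := Real.sqrt_pos.2 hp
      have h1 := Real.sq_sqrt hp.le
      have : √(F x) ≤ F t * (1 / √(F x)) := by
        rw [mul_one_div, le_div_iff₀ h0]; nlinarith
      linarith)
  have := key (left_mem_Icc.2 ht) (right_mem_Icc.2 ht) ht
  simp only [intervalIntegral.integral_same, zero_add] at this
  have := mul_nonneg (H.pos t (hT.trans ht)).le (H.tail_nonneg (hT.trans ht))
  linarith

end KellerOssermanTail

/-- The inverse `r` of a radial solution and its slope `p`, as functions of the height `t ≥ T`. -/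
structure HeightProfile (F : ℝ → ℝ) (c ρ T : ℝ) (r p : ℝ → ℝ) : Prop where
  slope_pos : ∀ t, T ≤ t → 0 < p t
  le_radius : ∀ t, T ≤ t → ρ ≤ r t
  hasDerivAt_radius : ∀ t, T ≤ t → HasDerivAt r (1 / p t) t
  hasDerivAt_energy : ∀ t, T ≤ t → HasDerivAt (fun t => F t - p t ^ 2 / 2) (c * p t / r t) t
  tendsto_radius : Tendsto r atTop (nhds 1)

namespace HeightProfile

variable {F Φ r p r₁ r₂ p₁ p₂ : ℝ → ℝ} {M c ρ T : ℝ}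

theorem mono (P : HeightProfile F c ρ T r p) {T' : ℝ} (h : T ≤ T') :
    HeightProfile F c ρ T' r p :=
  ⟨fun t ht => P.slope_pos t (h.trans ht), fun t ht => P.le_radius t (h.trans ht),
    fun t ht => P.hasDerivAt_radius t (h.trans ht),
    fun t ht => P.hasDerivAt_energy t (h.trans ht), P.tendsto_radius⟩

theorem energy_mono (P : HeightProfile F c ρ T r p) (hc : 0 ≤ c) (hρ : 0 < ρ) {t : ℝ}
    (ht : T ≤ t) : F T - p T ^ 2 / 2 ≤ F t - p t ^ 2 / 2 :=
  monotoneOn_Ici_of_hasDerivAt_nonneg P.hasDerivAt_energy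
    (fun x hx => div_nonneg (mul_nonneg hc (P.slope_pos x hx).le)
      (hρ.le.trans (P.le_radius x hx))) self_mem_Ici ht ht

theorem eventually_slope_le (P : HeightProfile F c ρ T r p) (H : KellerOssermanTail F Φ M)
    (hc : 0 ≤ c) (hρ : 0 < ρ) : ∀ᶠ t in atTop, p t ≤ 2 * √(F t) := by
  filter_upwards [eventually_ge_atTop T, eventually_ge_atTop M,
    H.tendsto.eventually_ge_atTop (-(F T - p T ^ 2 / 2))] with t hT hM hF
  have h1 := P.energy_mono hc hρ hT
  have h2 := Real.sq_sqrt (H.pos t hM).le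
  have h3 := Real.sqrt_nonneg (F t)
  refine abs_le_of_sq_le_sq' ?_ (by positivity) |>.2
  nlinarith

theorem energy_sub_le (P : HeightProfile F c ρ T r p) (H : KellerOssermanTail F Φ M)
    (hc : 0 ≤ c) (hρ : 0 < ρ) (hp : ∀ t, T ≤ t → p t ≤ 2 * √(F t)) {t : ℝ} (ht : T ≤ t) :
    (F t - p t ^ 2 / 2) - (F T - p T ^ 2 / 2) ≤ 2 * c / ρ * ∫ s in T..t, √(F s) := by
  have := monotoneOn_Ici_of_hasDerivAt_nonneg
    (φ := fun t => (2 * c / ρ * ∫ s in T..t, √(F s)) - (F t - p t ^ 2 / 2))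
    (fun x hx => ((KellerOssermanTail.hasDerivAt_integral_sqrt H.continuous T x).const_mul
      _).sub (P.hasDerivAt_energy x hx))
    (fun x hx => by
      have h1 := P.le_radius x hx
      have h2 : c * p x / r x ≤ c * (2 * √(F x)) / ρ := by
        have := P.slope_pos x hx
        have := hp x hx
        gcongr
      have h3 : 2 * c / ρ * √(F x) = c * (2 * √(F x)) / ρ := by ring
      linarith) self_mem_Ici ht ht
  simp only [intervalIntegral.integral_same, mul_zero] at this
  linarith

theorem eventually_sqrt_le_slope (P : HeightProfile F c ρ T r p)
    (H : KellerOssermanTail F Φ M) (hc : 0 ≤ c) (hρ : 0 < ρ) :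
    ∀ᶠ t in atTop, √(F t) ≤ p t := by
  have hlim : Tendsto (fun t => 2 * c / ρ * Φ t) atTop (nhds 0) := by
    simpa using H.tendsto_tail.const_mul (2 * c / ρ)
  obtain ⟨S, hS⟩ := eventually_atTop.1 ((P.eventually_slope_le H hc hρ).and
    ((eventually_ge_atTop T).and ((eventually_ge_atTop M).and
      (hlim.eventually_le_const (show (0 : ℝ) < 1 / 4 by norm_num)))))
  obtain ⟨-, hTS, hMS, hΦ⟩ := hS S le_rfl
  filter_upwards [eventually_ge_atTop S,
    H.tendsto.eventually_ge_atTop (4 * (F S - p S ^ 2 / 2))] with t ht hF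
  have h1 := (P.mono hTS).energy_sub_le H hc hρ (fun t ht => (hS t ht).1) ht
  have h2 := H.integral_sqrt_le hMS ht
  have h3 : 0 < F t := H.pos t (hMS.trans ht)
  have h4 : 2 * c / ρ * ∫ s in S..t, √(F s) ≤ F t / 4 := calc
    _ ≤ 2 * c / ρ * (F t * Φ S) := by gcongr
    _ = F t * (2 * c / ρ * Φ S) := by ring
    _ ≤ F t * (1 / 4) := by gcongr
    _ = F t / 4 := by ring
  refine Real.sqrt_le_iff.2 ⟨(P.slope_pos t (hTS.trans ht)).le, ?_⟩
  linarith

theorem abs_radius_sub_le (P₁ : HeightProfile F c ρ T r₁ p₁) (P₂ : HeightProfile F c ρ T r₂ p₂)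
    (H : KellerOssermanTail F Φ M) (hMT : M ≤ T)
    (hp₁ : ∀ t, T ≤ t → √(F t) ≤ p₁ t) (hp₂ : ∀ t, T ≤ t → √(F t) ≤ p₂ t) {A B : ℝ}
    (hA : 0 ≤ A) (hB : 0 ≤ B)
    (hAB : ∀ t, T ≤ t → |p₁ t ^ 2 / 2 - p₂ t ^ 2 / 2| ≤ A + B * ∫ s in T..t, √(F s))
    {s : ℝ} (hs : T ≤ s) : |r₂ s - r₁ s| ≤ (A / F s + B * Φ T) * Φ s := by
  set K := A / F s + B * Φ T with hK
  have hder : ∀ t, s ≤ t → |1 / p₂ t - 1 / p₁ t| ≤ K * (1 / √(F t)) := by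
    intro t hst
    have hTt := hs.trans hst
    have hFs := H.pos s (hMT.trans hs)
    have hFt := H.pos t (hMT.trans hTt)
    have hF := H.mono (hMT.trans hs) (hMT.trans hTt) hst
    have hq := Real.sqrt_pos.2 hFt
    have hsq := Real.sq_sqrt hFt.le
    have h1 := P₁.slope_pos t hTt
    have h2 := P₂.slope_pos t hTt
    have e : 1 / p₂ t - 1 / p₁ t
        = 2 * (p₁ t ^ 2 / 2 - p₂ t ^ 2 / 2) / ((p₁ t + p₂ t) * (p₁ t * p₂ t)) := by
      field_simp
      ring
    have hden : 2 * (F t * √(F t)) ≤ (p₁ t + p₂ t) * (p₁ t * p₂ t) := calc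
      _ = (√(F t) + √(F t)) * (√(F t) * √(F t)) := by nlinarith
      _ ≤ _ := by
        have := hp₁ t hTt
        have := hp₂ t hTt
        gcongr
    have hnum : |p₁ t ^ 2 / 2 - p₂ t ^ 2 / 2| ≤ F t * K := calc
      _ ≤ A + B * ∫ s in T..t, √(F s) := hAB t hTt
      _ ≤ A / F s * F t + B * (F t * Φ T) := by
        gcongr
        · rw [div_mul_eq_mul_div, le_div_iff₀ hFs]; gcongr
        · exact H.integral_sqrt_le hMT hTt
      _ = F t * K := by rw [hK]; ring
    rw [e, abs_div, abs_mul, abs_two,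
      abs_of_pos (by positivity : 0 < (p₁ t + p₂ t) * (p₁ t * p₂ t))]
    calc _ ≤ 2 * (F t * K) / (2 * (F t * √(F t))) := by
          have := (abs_nonneg _).trans hnum
          gcongr
      _ = K * (1 / √(F t)) := by field_simp
  have hr : Tendsto (fun t => r₂ t - r₁ t) atTop (nhds 0) := by
    simpa using P₂.tendsto_radius.sub P₁.tendsto_radius
  have hΦ : Tendsto (fun t => K * Φ t) atTop (nhds 0) := by
    simpa using H.tendsto_tail.const_mul K
  have hd : ∀ t, s ≤ t → HasDerivAt (fun t => r₂ t - r₁ t) (1 / p₂ t - 1 / p₁ t) t :=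
    fun t ht => (P₂.hasDerivAt_radius t (hs.trans ht)).sub
      (P₁.hasDerivAt_radius t (hs.trans ht))
  have hdΦ : ∀ t, s ≤ t → HasDerivAt (fun t => K * Φ t) (K * -(1 / √(F t))) t :=
    fun t ht => (H.hasDerivAt t (hMT.trans (hs.trans ht))).const_mul K
  have h1 := nonpos_of_hasDerivAt_nonneg_of_tendsto_zero
    (fun t ht => (hd t ht).sub (hdΦ t ht))
    (fun t ht => by linarith [(abs_le.1 (hder t ht)).1])
    (by rw [← sub_zero (0 : ℝ)]; exact hr.sub hΦ)
  have h2 := nonpos_of_hasDerivAt_nonneg_of_tendsto_zero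
    (fun t ht => (hd t ht).neg.sub (hdΦ t ht))
    (fun t ht => by linarith [(abs_le.1 (hder t ht)).2]) (by
      have := hr.neg.sub hΦ
      rw [neg_zero, sub_zero] at this
      exact this)
  simp only [Pi.sub_apply, Pi.neg_apply] at h1 h2
  rw [abs_le]
  constructor <;> linarith

theorem energy_gap_step (P₁ : HeightProfile F c ρ T r₁ p₁) (P₂ : HeightProfile F c ρ T r₂ p₂)
    (H : KellerOssermanTail F Φ M) (hMT : M ≤ T) (hc : 0 ≤ c) (hρ : 0 < ρ)
    (hp₁ : ∀ t, T ≤ t → √(F t) ≤ p₁ t) (hp₂ : ∀ t, T ≤ t → √(F t) ≤ p₂ t)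
    (hp₂' : ∀ t, T ≤ t → p₂ t ≤ 2 * √(F t))
    {σ : ℝ} (hσ0 : 0 < σ) (hσ : Φ T ≤ σ) (hσ2 : (2 * c / ρ ^ 2 + 1) * σ ^ 2 ≤ 1 / 2)
    {A B : ℝ} (hA : 0 < A) (hB : 0 < B)
    (hAB : ∀ t, T ≤ t → |p₁ t ^ 2 / 2 - p₂ t ^ 2 / 2| ≤ A + B * ∫ s in T..t, √(F s))
    {t : ℝ} (ht : T ≤ t) :
    p₂ t ^ 2 / 2 - p₁ t ^ 2 / 2
      ≤ |p₁ T ^ 2 / 2 - p₂ T ^ 2 / 2| + (A + B * ∫ s in T..t, √(F s)) / 2 := by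
  set κ := 2 * c / ρ ^ 2 + 1 with hκ
  have hκ0 : 0 < κ := by positivity
  set D := |p₁ T ^ 2 / 2 - p₂ T ^ 2 / 2| with hD
  have hderiv : ∀ x, T ≤ x → HasDerivAt (fun t => D + κ * σ * (A * (Φ T - Φ t)
      + B * σ * ∫ s in T..t, √(F s)))
      (κ * σ * (A * (-(-(1 / √(F x)))) + B * σ * √(F x))) x := fun x hx =>
    ((((H.hasDerivAt x (hMT.trans hx)).const_sub _).const_mul A |>.add
      ((KellerOssermanTail.hasDerivAt_integral_sqrt H.continuous T x).const_mul
        (B * σ))).const_mul (κ * σ)).const_add D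
  have hgap : ∀ x, T ≤ x → HasDerivAt (fun t => p₂ t ^ 2 / 2 - p₁ t ^ 2 / 2)
      (c * p₁ x / r₁ x - c * p₂ x / r₂ x) x := fun x hx => by
    refine ((P₁.hasDerivAt_energy x hx).sub (P₂.hasDerivAt_energy x hx)).congr_of_eventuallyEq ?_
    exact Eventually.of_forall fun y => by simp only [Pi.sub_apply]; ring
  have key := image_le_of_deriv_right_lt_deriv_boundary' (a := T) (b := t)
    (fun x hx => (hgap x hx.1).continuousAt.continuousWithinAt)
    (fun x hx => (hgap x hx.1).hasDerivWithinAt)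
    (B := fun t => D + κ * σ * (A * (Φ T - Φ t) + B * σ * ∫ s in T..t, √(F s)))
    (by
      simp only [sub_self, mul_zero, intervalIntegral.integral_same, add_zero, hD]
      rw [abs_sub_comm]
      exact le_abs_self _)
    (fun x hx => (hderiv x hx.1).continuousAt.continuousWithinAt)
    (fun x hx => (hderiv x hx.1).hasDerivWithinAt)
    (fun x hx hxB => by
      replace hx := hx.1
      have hFx := H.pos x (hMT.trans hx)
      have hq := Real.sqrt_pos.2 hFx
      have hsq := Real.sq_sqrt hFx.le
      have hΦx := H.tail_nonneg (hMT.trans hx)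
      have hΦT := H.tail_nonneg hMT
      have hΦ := H.tail_antitone hMT hx
      have h1 := P₁.slope_pos x hx
      have h2 := P₂.slope_pos x hx
      have hr1 := P₁.le_radius x hx
      have hr2 := P₂.le_radius x hx
      have hr1' := hρ.trans_le hr1
      have hr2' := hρ.trans_le hr2
      have hlt : p₁ x ≤ p₂ x := by
        have h0 : 0 ≤ p₂ x ^ 2 / 2 - p₁ x ^ 2 / 2 := by
          rw [hxB]
          have := KellerOssermanTail.integral_sqrt_nonneg (F := F) hx
          have := sub_nonneg.2 hΦ
          positivity
        exact abs_le_of_sq_le_sq' (by linarith) h2.le |>.2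
      have hrad := abs_radius_sub_le P₁ P₂ H hMT hp₁ hp₂ hA.le hB.le hAB hx
      have hx2 : |r₂ x - r₁ x| ≤ (A / F x + B * σ) * σ := hrad.trans (by gcongr; linarith)
      have e : c * p₂ x / r₁ x - c * p₂ x / r₂ x
          = c * p₂ x * (r₂ x - r₁ x) / (r₁ x * r₂ x) := by field_simp
      calc c * p₁ x / r₁ x - c * p₂ x / r₂ x
          ≤ c * p₂ x / r₁ x - c * p₂ x / r₂ x := by gcongr
        _ = c * p₂ x * (r₂ x - r₁ x) / (r₁ x * r₂ x) := e
        _ ≤ c * p₂ x * |r₂ x - r₁ x| / (r₁ x * r₂ x) := by gcongr; exact le_abs_self _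
        _ ≤ c * (2 * √(F x)) * ((A / F x + B * σ) * σ) / (ρ * ρ) := by
          have := hp₂' x hx
          gcongr
        _ = (2 * c / ρ ^ 2) * (σ * (A / F x * √(F x) + B * σ * √(F x))) := by
          field_simp
        _ < κ * (σ * (A / F x * √(F x) + B * σ * √(F x))) := by
          gcongr
          linarith
        _ = κ * σ * (A * (-(-(1 / √(F x)))) + B * σ * √(F x)) := by
          have : √(F x) / F x = 1 / √(F x) := by
            rw [div_eq_div_iff hFx.ne' hq.ne']; nlinarith
          rw [neg_neg, ← this]; ring) (right_mem_Icc.2 ht)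
  have hw := KellerOssermanTail.integral_sqrt_nonneg (F := F) ht
  have hΦt := H.tail_nonneg (hMT.trans ht)
  refine key.trans ?_
  calc D + κ * σ * (A * (Φ T - Φ t) + B * σ * ∫ s in T..t, √(F s))
      ≤ D + κ * σ * (A * σ + B * σ * ∫ s in T..t, √(F s)) := by
        gcongr
        linarith
    _ = D + κ * σ ^ 2 * (A + B * ∫ s in T..t, √(F s)) := by ring
    _ ≤ D + 1 / 2 * (A + B * ∫ s in T..t, √(F s)) := by gcongr
    _ = _ := by ring

/-- The energies of two profiles of the same equation stay at bounded distance. -/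
theorem exists_energy_gap_bound {T₁ T₂ ρ₁ ρ₂ : ℝ} (P₁ : HeightProfile F c ρ₁ T₁ r₁ p₁)
    (P₂ : HeightProfile F c ρ₂ T₂ r₂ p₂) (H : KellerOssermanTail F Φ M) (hc : 0 ≤ c)
    (hρ₁ : 0 < ρ₁) (hρ₂ : 0 < ρ₂) :
    ∃ C > (0 : ℝ), ∃ T, T₁ ≤ T ∧ T₂ ≤ T ∧
      ∀ t, T ≤ t → |p₁ t ^ 2 / 2 - p₂ t ^ 2 / 2| ≤ C := by
  obtain ⟨ρ, hρ, hρ1, hρ2⟩ : ∃ ρ > 0, ρ ≤ ρ₁ ∧ ρ ≤ ρ₂ :=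
    ⟨min ρ₁ ρ₂, lt_min hρ₁ hρ₂, min_le_left _ _, min_le_right _ _⟩
  replace P₁ : HeightProfile F c ρ T₁ r₁ p₁ :=
    { P₁ with le_radius := fun t ht => hρ1.trans (P₁.le_radius t ht) }
  replace P₂ : HeightProfile F c ρ T₂ r₂ p₂ :=
    { P₂ with le_radius := fun t ht => hρ2.trans (P₂.le_radius t ht) }
  obtain ⟨σ, hσ0, hσ2⟩ : ∃ σ > 0, (2 * c / ρ ^ 2 + 1) * σ ^ 2 ≤ 1 / 2 := by
    have h1 : 1 ≤ 2 * c / ρ ^ 2 + 1 := by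
      have : 0 ≤ 2 * c / ρ ^ 2 := by positivity
      linarith
    refine ⟨1 / (2 * (2 * c / ρ ^ 2 + 1)), by positivity, ?_⟩
    generalize 2 * c / ρ ^ 2 + 1 = κ at *
    have : κ * (1 / (2 * κ)) ^ 2 = 1 / (4 * κ) := by field_simp; norm_num
    rw [this]
    exact one_div_le_one_div_of_le two_pos (by linarith)
  obtain ⟨T, hT⟩ := eventually_atTop.1 ((P₁.eventually_slope_le H hc hρ).and
    ((P₂.eventually_slope_le H hc hρ).and ((P₁.eventually_sqrt_le_slope H hc hρ).and
    ((P₂.eventually_sqrt_le_slope H hc hρ).and ((eventually_ge_atTop T₁).and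
    ((eventually_ge_atTop T₂).and ((eventually_ge_atTop M).and
      (H.tendsto_tail.eventually_le_const hσ0))))))))
  obtain ⟨-, -, -, -, hT1, hT2, hMT, hσ⟩ := hT T le_rfl
  have hu₁ := fun t ht => (hT t ht).1
  have hu₂ := fun t ht => (hT t ht).2.1
  have hl₁ := fun t ht => (hT t ht).2.2.1
  have hl₂ := fun t ht => (hT t ht).2.2.2.1
  replace P₁ := P₁.mono hT1
  replace P₂ := P₂.mono hT2
  set D := |p₁ T ^ 2 / 2 - p₂ T ^ 2 / 2| with hD
  have hD0 : 0 ≤ D := abs_nonneg _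
  set W : ℝ → ℝ := fun t => ∫ s in T..t, √(F s) with hW
  have hW0 : ∀ t, T ≤ t → 0 ≤ W t := fun t ht => KellerOssermanTail.integral_sqrt_nonneg ht
  set K := 2 * c / ρ + 1 with hK
  have hK0 : 0 < K := by positivity
  have hstep : ∀ A B : ℝ, 0 < A → 0 < B →
      (∀ t, T ≤ t → |p₁ t ^ 2 / 2 - p₂ t ^ 2 / 2| ≤ A + B * W t) →
      ∀ t, T ≤ t → |p₁ t ^ 2 / 2 - p₂ t ^ 2 / 2| ≤ D + (A + B * W t) / 2 := by
    intro A B hA hB hAB t ht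
    have s1 := energy_gap_step P₁ P₂ H hMT hc hρ hl₁ hl₂ hu₂ hσ0 hσ hσ2 hA hB hAB ht
    have s2 := energy_gap_step P₂ P₁ H hMT hc hρ hl₂ hl₁ hu₁ hσ0 hσ hσ2 hA hB
      (fun t ht => by rw [abs_sub_comm]; exact hAB t ht) ht
    rw [abs_sub_comm (p₂ T ^ 2 / 2)] at s2
    exact abs_le.2 ⟨by linarith, s2⟩
  have hbase : ∀ t, T ≤ t → |p₁ t ^ 2 / 2 - p₂ t ^ 2 / 2| ≤ D + K * W t := by
    intro t ht
    have a1 := P₁.energy_sub_le H hc hρ hu₁ ht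
    have a2 := P₂.energy_sub_le H hc hρ hu₂ ht
    have b1 := P₁.energy_mono hc hρ ht
    have b2 := P₂.energy_mono hc hρ ht
    have hDle := abs_le.1 (le_of_eq hD.symm)
    have : K * W t = 2 * c / ρ * (∫ s in T..t, √(F s)) + W t := by rw [hK]; ring
    have := hW0 t ht
    exact abs_le.2 ⟨by linarith, by linarith⟩
  have hiter : ∀ n : ℕ, ∀ t, T ≤ t →
      |p₁ t ^ 2 / 2 - p₂ t ^ 2 / 2| ≤ (2 * D + 1) + K * (1 / 2) ^ n * W t := by
    intro n
    induction n with
    | zero => intro t ht; have := hbase t ht; simp only [pow_zero, mul_one]; linarith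
    | succ n ih =>
      intro t ht
      have := hstep _ _ (by positivity) (by positivity) ih t ht
      calc _ ≤ _ := this
        _ = (2 * D + 1 / 2) + K * (1 / 2) ^ (n + 1) * W t := by ring
        _ ≤ _ := by linarith
  refine ⟨2 * D + 1, by positivity, T, hT1, hT2, fun t ht => ?_⟩
  have hlim : Tendsto (fun n : ℕ => (2 * D + 1) + K * (1 / 2 : ℝ) ^ n * W t) atTop
      (nhds ((2 * D + 1) + K * 0 * W t)) :=
    (((tendsto_pow_atTop_nhds_zero_of_lt_one (by norm_num) (by norm_num)).const_mul
      K).mul_const _).const_add _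
  have := ge_of_tendsto' hlim fun n => hiter n t ht
  simpa using this

end HeightProfile

theorem exists_pos_deriv_of_radial {f u : ℝ → ℝ} {a c r₀ : ℝ} (hc : 0 ≤ c) (hr₀ : 0 ≤ r₀)
    (hr₀1 : r₀ < 1) (hfpos : ∀ t, a < t → 0 ≤ f t) (hu : ContDiffOn ℝ 2 u (Ioo r₀ 1))
    (hmono : StrictMonoOn u (Ioo r₀ 1))
    (hode : ∀ r ∈ Ioo r₀ 1, deriv (deriv u) r + c / r * deriv u r = f (u r))
    (hblow : Tendsto u (nhdsWithin 1 (Iio 1)) atTop) :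
    ∃ ρ ∈ Ioo r₀ 1, ∀ x ∈ Ico ρ 1, 0 < deriv u x := by
  have hd : ∀ x ∈ Ioo r₀ 1, DifferentiableAt ℝ u x := fun x hx =>
    (hu.differentiableOn two_ne_zero).differentiableAt (isOpen_Ioo.mem_nhds hx)
  have hd2 : ∀ x ∈ Ioo r₀ 1, DifferentiableAt ℝ (deriv u) x := fun x hx =>
    ((hu.deriv_of_isOpen isOpen_Ioo (by norm_num : (1 : WithTop ℕ∞) + 1 ≤ 2)).differentiableOn
      one_ne_zero).differentiableAt (isOpen_Ioo.mem_nhds hx)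
  have hnn : ∀ x ∈ Ioo r₀ 1, 0 ≤ deriv u x := fun x hx => by
    rw [← derivWithin_of_isOpen isOpen_Ioo hx]
    exact hmono.monotoneOn.derivWithin_nonneg
  obtain ⟨x₀, hx₀a, hx₀⟩ := ((hblow.eventually_gt_atTop a).and
    (Ioo_mem_nhdsLT hr₀1)).exists
  obtain ⟨x₁, hx₀₁, hx₁⟩ := exists_between hx₀.2
  obtain ⟨ρ, hρ, hρd⟩ := exists_deriv_eq_slope u hx₀₁
    (fun x hx => (hd x ⟨hx₀.1.trans_le hx.1, hx.2.trans_lt hx₁⟩).continuousAt.continuousWithinAt)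
    (fun x hx =>
      (hd x ⟨hx₀.1.trans hx.1, hx.2.trans hx₁⟩).differentiableWithinAt)
  have hρ0 : r₀ < ρ := hx₀.1.trans hρ.1
  have hρpos : 0 < ρ := hr₀.trans_lt hρ0
  have hderρ : 0 < deriv u ρ := by
    rw [hρd]
    exact div_pos (sub_pos.2 (hmono hx₀ ⟨hx₀.1.trans hx₀₁, hx₁⟩ hx₀₁)) (sub_pos.2 hx₀₁)
  refine ⟨ρ, ⟨hρ0, hρ.2.trans hx₁⟩, fun x hx => ?_⟩
  have hmem : ∀ y ∈ Ico ρ 1, y ∈ Ioo r₀ 1 := fun y hy => ⟨hρ0.trans_le hy.1, hy.2⟩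
  have hder : ∀ y ∈ Ico ρ 1, HasDerivAt (fun y => Real.exp (c / ρ * y) * deriv u y)
      (Real.exp (c / ρ * y) * (c / ρ * 1) * deriv u y
        + Real.exp (c / ρ * y) * deriv (deriv u) y) y := fun y hy =>
    (((hasDerivAt_id y).const_mul (c / ρ)).exp).mul (hd2 y (hmem y hy)).hasDerivAt
  have key := monotoneOn_of_hasDerivWithinAt_nonneg (convex_Ico ρ 1)
    (fun y hy => (hder y hy).continuousAt.continuousWithinAt)
    (fun y hy => (hder y (interior_subset hy)).hasDerivWithinAt)
    (fun y hy => by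
      replace hy := interior_subset hy
      have hy' := hmem y hy
      have h1 := hnn y hy'
      have h2 := hode y hy'
      have h3 := hfpos (u y) (hx₀a.trans (hmono hx₀ hy' (hρ.1.trans_le hy.1)))
      have h4 : c / y * deriv u y ≤ c / ρ * deriv u y := by
        have := hy.1
        gcongr
      have h5 : 0 ≤ Real.exp (c / ρ * y) * (c / ρ * deriv u y + deriv (deriv u) y) :=
        mul_nonneg (Real.exp_pos _).le (by linarith)
      linarith)
  have := key ⟨le_rfl, hx.1.trans_lt hx.2⟩ hx hx.1
  have h6 : 0 < Real.exp (c / ρ * x) * deriv u x :=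
    (mul_pos (Real.exp_pos _) hderρ).trans_le this
  exact pos_of_mul_pos_right h6 (Real.exp_pos _).le

/-- An increasing radial solution blowing up at `1` can be parametrized by its height. -/
theorem exists_heightProfile {f F u : ℝ → ℝ} {a c r₀ : ℝ} (hc : 0 ≤ c) (hr₀ : 0 ≤ r₀)
    (hr₀1 : r₀ < 1) (hF : ∀ t, HasDerivAt F (f t) t)
    (hfpos : ∀ t, a < t → 0 ≤ f t) (hu : ContDiffOn ℝ 2 u (Ioo r₀ 1))
    (hmono : StrictMonoOn u (Ioo r₀ 1))
    (hode : ∀ r ∈ Ioo r₀ 1, deriv (deriv u) r + c / r * deriv u r = f (u r))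
    (hblow : Tendsto u (nhdsWithin 1 (Iio 1)) atTop) :
    ∃ ρ > 0, ∃ T, ∃ r : ℝ → ℝ, HeightProfile F c ρ T r (fun t => deriv u (r t)) ∧
      ∀ x ∈ Ioo r₀ 1, T ≤ u x → r (u x) = x := by
  have hd : ∀ x ∈ Ioo r₀ 1, DifferentiableAt ℝ u x := fun x hx =>
    (hu.differentiableOn two_ne_zero).differentiableAt (isOpen_Ioo.mem_nhds hx)
  have hd2 : ∀ x ∈ Ioo r₀ 1, DifferentiableAt ℝ (deriv u) x := fun x hx =>
    ((hu.deriv_of_isOpen isOpen_Ioo (by norm_num : (1 : WithTop ℕ∞) + 1 ≤ 2)).differentiableOn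
      one_ne_zero).differentiableAt (isOpen_Ioo.mem_nhds hx)
  obtain ⟨ρ, hρ, hpos⟩ := exists_pos_deriv_of_radial hc hr₀ hr₀1 hfpos hu hmono hode hblow
  have hρpos : 0 < ρ := hr₀.trans_lt hρ.1
  have hmem : ∀ y ∈ Ioo ρ 1, y ∈ Ioo r₀ 1 := fun y hy => ⟨hρ.1.trans hy.1, hy.2⟩
  have hex : ∀ t, u ρ < t → ∃ x ∈ Ioo ρ 1, u x = t := fun t ht => by
    obtain ⟨y, hty, hy⟩ := ((hblow.eventually_gt_atTop t).and (Ioo_mem_nhdsLT hρ.2)).exists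
    obtain ⟨x, hx, hxt⟩ := intermediate_value_Ioo hy.1.le
      (fun z hz => (hd z ⟨hρ.1.trans_le hz.1, hz.2.trans_lt hy.2⟩).continuousAt.continuousWithinAt)
      ⟨ht, hty⟩
    exact ⟨x, ⟨hx.1, hx.2.trans hy.2⟩, hxt⟩
  choose! r hr hur using hex
  have hinv : ∀ x ∈ Ioo r₀ 1, u ρ < u x → r (u x) = x := fun x hx h =>
    hmono.injOn (hmem _ (hr _ h)) hx (hur _ h)
  have hrmono : StrictMonoOn r (Ioi (u ρ)) := fun s hs t ht hst => by
    by_contra! h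
    have := hmono.monotoneOn (hmem _ (hr _ ht)) (hmem _ (hr _ hs)) h
    rw [hur _ ht, hur _ hs] at this
    exact absurd hst this.not_gt
  have himage : ∀ x ∈ Ioo ρ 1, x ∈ r '' Ioi (u ρ) := fun x hx =>
    have h := hmono hρ (hmem x hx) hx.1
    ⟨u x, h, hinv x (hmem x hx) h⟩
  have hrder : ∀ t, u ρ < t → HasDerivAt r (1 / deriv u (r t)) t := fun t ht => by
    have hcont : ContinuousAt r t := hrmono.continuousAt_of_image_mem_nhds (Ioi_mem_nhds ht)
      (mem_of_superset (isOpen_Ioo.mem_nhds (hr t ht)) himage)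
    rw [one_div]
    refine HasDerivAt.of_local_left_inverse hcont (hd _ (hmem _ (hr t ht))).hasDerivAt
      (hpos _ (Ioo_subset_Ico_self (hr t ht))).ne' ?_
    filter_upwards [Ioi_mem_nhds ht] with y hy using hur y hy
  refine ⟨ρ, hρpos, u ρ + 1, r, ⟨fun t ht => ?_, fun t ht => ?_, fun t ht => ?_, fun t ht => ?_,
    ?_⟩, fun x hx h => hinv x hx (by linarith)⟩
  · exact hpos _ (Ioo_subset_Ico_self (hr t (by linarith)))
  · exact (hr t (by linarith)).1.le
  · exact hrder t (by linarith)
  · have ht' : u ρ < t := by linarith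
    have hp := hpos _ (Ioo_subset_Ico_self (hr t ht'))
    have hm := hmem _ (hr t ht')
    have hrp : 0 < r t := hρpos.trans (hr t ht').1
    have h1 := (hF t).sub ((((hd2 _ hm).hasDerivAt.comp t (hrder t ht')).pow 2).div_const 2)
    refine h1.congr_deriv ?_
    have h2 := hode _ hm
    rw [hur t ht'] at h2
    rw [← h2]
    simp only [Function.comp_apply]
    field_simp
    ring
  · refine tendsto_order.2 ⟨fun b hb => ?_, fun b hb => ?_⟩
    · obtain ⟨y, hby, hy⟩ := exists_between (max_lt hb hρ.2)
      have hy' : y ∈ Ioo ρ 1 := ⟨(le_max_right _ _).trans_lt hby, hy⟩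
      have h := hmono hρ (hmem y hy') hy'.1
      filter_upwards [eventually_gt_atTop (u y)] with t ht
      have := hrmono h (h.trans ht) ht
      rw [hinv y (hmem y hy') h] at this
      exact ((le_max_left _ _).trans_lt hby).trans this
    · filter_upwards [eventually_gt_atTop (u ρ)] with t ht
      exact (hr t ht).2.trans hb

theorem exists_kellerOssermanTail {f F : ℝ → ℝ} {a : ℝ} (hf : Continuous f) (ha : 0 < f a)
    (hfpos : ∀ t, a < t → 0 ≤ f t) (hF : ∀ t, F t = ∫ s in a..t, f s)
    (hF' : ∀ t, HasDerivAt F (f t) t)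
    (hKO : ∃ M, a < M ∧ IntegrableOn (fun t => 1 / √(F t)) (Ici M)) :
    ∃ Φ M, KellerOssermanTail F Φ M := by
  obtain ⟨M, haM, hint⟩ := hKO
  have hcont : Continuous F := continuous_iff_continuousAt.2 fun t => (hF' t).continuousAt
  have hpos : ∀ t, a < t → 0 < F t := fun t ht => by
    rw [hF]
    exact intervalIntegral.integral_pos ht hf.continuousOn (fun x hx => hfpos x hx.1)
      ⟨a, left_mem_Icc.2 ht.le, ha⟩
  have hmono : MonotoneOn F (Ici M) := monotoneOn_Ici_of_hasDerivAt_nonneg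
    (fun t _ => hF' t) fun t ht => hfpos t (haM.trans_le ht)
  have hunbdd : ∀ b, ∃ t, M ≤ t ∧ b ≤ F t := by
    by_contra! ⟨b, hb⟩
    have hb0 : 0 < b := (hpos M haM).trans (hb M le_rfl)
    have hconst : IntegrableOn (fun _ : ℝ => 1 / √b) (Ici M) := by
      refine Integrable.mono' hint aestronglyMeasurable_const ?_
      refine (ae_restrict_iff' measurableSet_Ici).2 (Eventually.of_forall fun t ht => ?_)
      have := Real.sqrt_pos.2 (hpos t (haM.trans_le ht))
      rw [Real.norm_of_nonneg (by positivity)]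
      exact one_div_le_one_div_of_le this (Real.sqrt_le_sqrt (hb t ht).le)
    rw [integrableOn_const_iff (by simp)] at hconst
    simp [(Real.sqrt_pos.2 hb0).ne', Real.volume_Ici] at hconst
  set φ : ℝ → ℝ := fun t => 1 / √(F t) with hφ
  have hIoi : IntegrableOn φ (Ioi M) := hint.mono_set Ioi_subset_Ici_self
  have hder : ∀ t, M ≤ t →
      HasDerivAt (fun t => (∫ s in Ioi M, φ s) - ∫ s in M..t, φ s) (-(1 / √(F t))) t := by
    intro t ht
    have hsm : StronglyMeasurable φ := by
      apply Measurable.stronglyMeasurable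
      exact measurable_const.div hcont.sqrt.measurable
    refine HasDerivAt.const_sub _ (intervalIntegral.integral_hasDerivAt_right ?_ ?_ ?_)
    · rw [intervalIntegrable_iff_integrableOn_Ioc_of_le ht]
      exact hIoi.mono_set Ioc_subset_Ioi_self
    · exact hsm.stronglyMeasurableAtFilter
    · exact continuousAt_const.div hcont.sqrt.continuousAt
        (Real.sqrt_pos.2 (hpos t (haM.trans_le ht))).ne'
  refine ⟨_, M, hcont, fun t ht => hpos t (haM.trans_le ht), hmono,
    tendsto_atTop.2 fun b => ?_, hder, ?_⟩
  · obtain ⟨t, ht, hbt⟩ := hunbdd b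
    filter_upwards [eventually_ge_atTop t] with x hx
    exact hbt.trans (hmono ht (ht.trans hx) hx)
  · have := (intervalIntegral_tendsto_integral_Ioi M hIoi tendsto_id).const_sub
      (∫ s in Ioi M, φ s)
    simpa using this

theorem stmt17 {N : ℕ} (hN : 1 ≤ N)
    (f : ℝ → ℝ) (hf : Continuous f)
    (a : ℝ) (ha : 0 < f a) (hfpos : ∀ t, a < t → 0 ≤ f t)
    (F : ℝ → ℝ) (hF : ∀ t, F t = ∫ s in a..t, f s)
    (hKO : ∃ M, a < M ∧ IntegrableOn (fun t => 1 / Real.sqrt (F t)) (Ici M))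
    (r₀ : ℝ) (hr₀ : 0 ≤ r₀) (hr₀1 : r₀ < 1)
    (u₁ u₂ : ℝ → ℝ)
    (h₁C2 : ContDiffOn ℝ 2 u₁ (Ioo r₀ 1)) (h₂C2 : ContDiffOn ℝ 2 u₂ (Ioo r₀ 1))
    (h₁mono : StrictMonoOn u₁ (Ioo r₀ 1)) (h₂mono : StrictMonoOn u₂ (Ioo r₀ 1))
    (h₁ode : ∀ r ∈ Ioo r₀ 1,
      deriv (deriv u₁) r + ((N : ℝ) - 1) / r * deriv u₁ r = f (u₁ r))
    (h₂ode : ∀ r ∈ Ioo r₀ 1,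
      deriv (deriv u₂) r + ((N : ℝ) - 1) / r * deriv u₂ r = f (u₂ r))
    (h₁blow : Tendsto u₁ (nhdsWithin 1 (Iio 1)) atTop)
    (h₂blow : Tendsto u₂ (nhdsWithin 1 (Iio 1)) atTop)
    (g₁ g₂ : ℝ → ℝ)
    (hg₁ : ∀ r, g₁ r = F (u₁ r) - (deriv u₁ r) ^ 2 / 2)
    (hg₂ : ∀ r, g₂ r = F (u₂ r) - (deriv u₂ r) ^ 2 / 2) :
    ∃ C > (0:ℝ), ∃ T : ℝ, ∀ r₁ ∈ Ioo r₀ 1, ∀ r₂ ∈ Ioo r₀ 1,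
      u₁ r₁ = u₂ r₂ → T ≤ u₁ r₁ → |g₁ r₁ - g₂ r₂| ≤ C := by
  have hF' : ∀ t, HasDerivAt F (f t) t := fun t => by
    rw [funext hF]
    exact (hf.integral_hasStrictDerivAt a t).hasDerivAt
  have hc : (0 : ℝ) ≤ (N : ℝ) - 1 := sub_nonneg.2 (by exact_mod_cast hN)
  obtain ⟨Φ, M, H⟩ := exists_kellerOssermanTail hf ha hfpos hF hF' hKO
  obtain ⟨ρ₁, hρ₁, T₁, s₁, P₁, hs₁⟩ :=
    exists_heightProfile hc hr₀ hr₀1 hF' hfpos h₁C2 h₁mono h₁ode h₁blow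
  obtain ⟨ρ₂, hρ₂, T₂, s₂, P₂, hs₂⟩ :=
    exists_heightProfile hc hr₀ hr₀1 hF' hfpos h₂C2 h₂mono h₂ode h₂blow
  obtain ⟨C, hC, T, hT₁, hT₂, hbound⟩ := P₁.exists_energy_gap_bound P₂ H hc hρ₁ hρ₂
  refine ⟨C, hC, T, fun x hx y hy hxy hT => ?_⟩
  have := hbound (u₁ x) hT
  have e₂ : s₂ (u₁ x) = y := by rw [hxy]; exact hs₂ y hy (hxy ▸ hT₂.trans hT)
  rw [hs₁ x hx (hT₁.trans hT), e₂, abs_sub_comm] at this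
  rw [hg₁, hg₂, ← hxy, sub_sub_sub_cancel_left]
  exact this
end

section
/- Let f be continuous satisfying (P), (KO) and condition (1.5), and let u₁, u₂ be two large solutions of Δu = f(u) in the open unit ball B of ℝ^N. Then the radial integrals of |f(u₁) − f(u₂)| are uniformly bounded over all directions: there exists C > 0 such that for every θ ∈ ℝ^N with ‖θ‖ = 1, ∫_0^1 |f(u₁(rθ)) − f(u₂(rθ))| dr ≤ C. -/
open MeasureTheory Filter Metric Set

/-- The Laplacian of `u : ℝ^N → ℝ` at a point, as the sum of the second
derivatives in the coordinate directions. -/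
noncomputable def lapl {N : ℕ} (u : EuclideanSpace ℝ (Fin N) → ℝ)
    (x : EuclideanSpace ℝ (Fin N)) : ℝ :=
  ∑ i : Fin N, iteratedFDeriv ℝ 2 u x ![EuclideanSpace.single i 1, EuclideanSpace.single i 1]

/-- A large solution of Δu = f(u) on the open unit ball of ℝ^N. -/
def IsLargeSolution {N : ℕ} (f : ℝ → ℝ) (u : EuclideanSpace ℝ (Fin N) → ℝ) : Prop :=
  ContDiffOn ℝ 2 u (ball 0 1) ∧
  (∀ x ∈ ball (0 : EuclideanSpace ℝ (Fin N)) 1, lapl u x = f (u x)) ∧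
  ∀ x₀ ∈ sphere (0 : EuclideanSpace ℝ (Fin N)) 1,
    Tendsto u (nhdsWithin x₀ (ball 0 1)) atTop

open scoped Topology

/-- A function which only jumps upwards from the left and whose lower right Dini derivative is
nonnegative does not decrease. -/
theorem le_of_dini {G : ℝ → ℝ} {a b : ℝ} (hab : a ≤ b)
    (hl : ∀ c ∈ Ioc a b, ∃ g : ℝ → ℝ, Tendsto g (𝓝[<] c) (𝓝 (G c)) ∧ ∀ᶠ y in 𝓝[<] c, G y ≤ g y)
    (hr : ∀ x ∈ Ico a b, ∀ ε > 0, ∀ᶠ y in 𝓝[>] x, G x - ε * (y - x) ≤ G y) : G a ≤ G b := by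
  have key : ∀ ε > 0, G a - ε * (b - a) ≤ G b := by
    intro ε hε
    set S : Set ℝ := {x | x ∈ Icc a b ∧ ∀ y ∈ Icc a x, G a - ε * (y - a) ≤ G y} with hS
    have haS : a ∈ S := by
      refine ⟨⟨le_rfl, hab⟩, fun y hy => ?_⟩
      obtain rfl : y = a := le_antisymm hy.2 hy.1
      simp
    have hbdd : BddAbove S := ⟨b, fun x hx => hx.1.2⟩
    set c := sSup S with hc
    have hac : a ≤ c := le_csSup hbdd haS
    have hcb : c ≤ b := csSup_le ⟨a, haS⟩ fun x hx => hx.1.2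
    have hlt : ∀ y, a ≤ y → y < c → G a - ε * (y - a) ≤ G y := by
      intro y hay hyc
      obtain ⟨x, hx, hyx⟩ := exists_lt_of_lt_csSup ⟨a, haS⟩ hyc
      exact hx.2 y ⟨hay, hyx.le⟩
    have hcc : G a - ε * (c - a) ≤ G c := by
      rcases hac.eq_or_lt with h | h
      · rw [← h]; simp
      · obtain ⟨g, hg, hGg⟩ := hl c ⟨h, hcb⟩
        have h1 : Tendsto (fun x => G a - ε * (x - a)) (𝓝[<] c) (𝓝 (G a - ε * (c - a))) := by
          apply Tendsto.mono_left _ nhdsWithin_le_nhds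
          apply Continuous.tendsto
          fun_prop
        refine le_of_tendsto_of_tendsto h1 hg ?_
        filter_upwards [Ioo_mem_nhdsLT h, hGg] with x hx hx'
        exact (hlt x hx.1.le hx.2).trans hx'
    have hcS : c ∈ S := by
      refine ⟨⟨hac, hcb⟩, fun y hy => ?_⟩
      rcases hy.2.eq_or_lt with h | h
      · rw [h]; exact hcc
      · exact hlt y hy.1 h
    rcases hcb.eq_or_lt with h | h
    · rw [← h]; exact hcc
    · exfalso
      have h1 := hr c ⟨hac, h⟩ ε hε
      rw [eventually_nhdsWithin_iff, Metric.eventually_nhds_iff] at h1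
      obtain ⟨η, hη, h1⟩ := h1
      set d := min (c + η / 2) b with hd
      have hcd : c < d := lt_min (by linarith) h
      have hdS : d ∈ S := by
        refine ⟨⟨hac.trans hcd.le, min_le_right _ _⟩, fun y hy => ?_⟩
        rcases le_or_gt y c with hyc | hyc
        · exact hcS.2 y ⟨hy.1, hyc⟩
        · have h3 : y ≤ c + η / 2 := hy.2.trans (min_le_left _ _)
          have := h1 (y := y) (by rw [Real.dist_eq, abs_of_pos (by linarith)]; linarith) hyc
          linarith
      exact absurd (le_csSup hbdd hdS) (not_le.mpr hcd)
  have h1 : Tendsto (fun ε => G a - ε * (b - a)) (𝓝[>] 0) (𝓝 (G a - 0 * (b - a))) := by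
    apply Tendsto.mono_left _ nhdsWithin_le_nhds
    apply Continuous.tendsto
    fun_prop
  have := le_of_tendsto h1 (eventually_nhdsWithin_of_forall fun ε hε => key ε hε)
  simpa using this

/-- A continuous function with nonnegative right derivative is monotone. -/
theorem le_of_right_deriv_nonneg {G g : ℝ → ℝ} {a b : ℝ} (hab : a ≤ b)
    (hG : ContinuousOn G (Icc a b)) (hd : ∀ x ∈ Ico a b, HasDerivWithinAt G (g x) (Ioi x) x)
    (hg : ∀ x ∈ Ico a b, 0 ≤ g x) : G a ≤ G b := by
  have := image_le_of_deriv_right_le_deriv_boundary (f := fun _ => G a) (f' := fun _ => 0)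
    (B := G) (B' := g) continuousOn_const (fun x _ => (hasDerivWithinAt_const _ _ _)) le_rfl hG
    (fun x hx => (hd x hx).Ici_of_Ioi) hg (right_mem_Icc.mpr hab)
  exact this

/-- `V` has right derivative `p`, and `p' ≥ α` in the integrated sense. -/
structure SubPrim (V p α : ℝ → ℝ) (s : Set ℝ) : Prop where
  cont : ContinuousOn V s
  deriv : ∀ x ∈ s, HasDerivWithinAt V (p x) (Ioi x) x
  incr : ∀ x ∈ s, ∀ y ∈ s, x ≤ y → ∫ t in x..y, α t ≤ p y - p x

/-- `V'' ≥ α` at `x` in the viscosity sense. -/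
def ViscositySub (V α : ℝ → ℝ) (x : ℝ) : Prop :=
  ∀ (h h' : ℝ → ℝ) (c : ℝ), (∀ᶠ y in 𝓝 x, HasDerivAt h (h' y) y) → HasDerivAt h' c x →
    IsLocalMax (fun y => V y - h y) x → α x ≤ c

theorem hasDerivAt_primitive {α : ℝ → ℝ} {l r m t : ℝ} (hα : ContinuousOn α (Ioo l r))
    (hm : m ∈ Ioo l r) (ht : t ∈ Ioo l r) :
    HasDerivAt (fun x => ∫ y in m..x, α y) (α t) t := by
  have hsub : uIcc m t ⊆ Ioo l r := ordConnected_Ioo.uIcc_subset hm ht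
  exact intervalIntegral.integral_hasDerivAt_right ((hα.mono hsub).intervalIntegrable)
    (hα.stronglyMeasurableAtFilter isOpen_Ioo t ht) (hα.continuousAt (isOpen_Ioo.mem_nhds ht))

theorem exists_subPrim_of_viscositySub {V α : ℝ → ℝ} {l r : ℝ} (hV : ContinuousOn V (Ioo l r))
    (hα : ContinuousOn α (Ioo l r)) (hvisc : ∀ x ∈ Ioo l r, ViscositySub V α x) :
    ∃ p, SubPrim V p α (Ioo l r) := by
  rcases le_or_gt r l with hlr | hlr
  · exact ⟨0, by simp [Ioo_eq_empty (not_lt.mpr hlr)], by simp [Ioo_eq_empty (not_lt.mpr hlr)],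
      by simp [Ioo_eq_empty (not_lt.mpr hlr)]⟩
  obtain ⟨m, hm⟩ := nonempty_Ioo.mpr hlr
  set H₁ : ℝ → ℝ := fun x => ∫ y in m..x, α y with hH₁
  have hd1 : ∀ t ∈ Ioo l r, HasDerivAt H₁ (α t) t := fun t ht => hasDerivAt_primitive hα hm ht
  have hc1 : ContinuousOn H₁ (Ioo l r) := fun t ht => (hd1 t ht).continuousAt.continuousWithinAt
  set H : ℝ → ℝ := fun x => ∫ y in m..x, H₁ y with hH
  have hd : ∀ t ∈ Ioo l r, HasDerivAt H (H₁ t) t := fun t ht => hasDerivAt_primitive hc1 hm ht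
  have hc : ContinuousOn H (Ioo l r) := fun t ht => (hd t ht).continuousAt.continuousWithinAt
  have hconv : ConvexOn ℝ (Ioo l r) (fun x => V x - H x) := by
    apply convexOn_of_slope_mono_adjacent (convex_Ioo l r)
    intro x y z hx hz hxy hyz
    set Y : ℝ → ℝ := fun x => V x - H x with hY
    change (Y y - Y x) / (y - x) ≤ (Y z - Y y) / (z - y)
    by_contra! hlt
    set k := (Y z - Y x) / (z - x) with hk
    have hkz : Y z - Y x = k * (z - x) := by
      rw [hk, div_mul_cancel₀]
      exact (by linarith : 0 < z - x).ne'
    have hpos : 0 < Y y - Y x - k * (y - x) := by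
      rw [div_lt_div_iff₀ (by linarith) (by linarith)] at hlt
      have h4 : (Y z - Y x) * (y - x) < (Y y - Y x) * (z - x) := by nlinarith
      rw [hkz] at h4
      have h5 : 0 < (Y y - Y x - k * (y - x)) * (z - x) := by linarith
      exact pos_of_mul_pos_left h5 (by linarith)
    set A := Y y - Y x - k * (y - x) with hA
    obtain ⟨ε, hε, hεA⟩ : ∃ ε > 0, ε * ((y - x) * (z - y)) < A := by
      have hq : 0 < (y - x) * (z - y) := mul_pos (by linarith) (by linarith)
      refine ⟨A / 2 / ((y - x) * (z - y)), by positivity, ?_⟩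
      rw [div_mul_cancel₀ _ hq.ne']; linarith
    set G : ℝ → ℝ := fun t => V t - (H t + (Y x + k * (t - x)) - ε * ((t - x) * (t - z))) with hG
    have hsub : Icc x z ⊆ Ioo l r := ordConnected_Ioo.out hx hz
    have hGc : ContinuousOn G (Icc x z) := by
      apply ContinuousOn.sub (hV.mono hsub)
      apply ContinuousOn.sub
      · exact (hc.mono hsub).add (by fun_prop)
      · fun_prop
    obtain ⟨t, ht, hmax⟩ := isCompact_Icc.exists_isMaxOn (nonempty_Icc.mpr (hxy.trans hyz).le) hGc
    have hGx : G x = 0 := by simp only [hG, hY]; ring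
    have hGz : G z = 0 := by
      have : G z = Y z - Y x - k * (z - x) := by simp only [hG, hY]; ring
      rw [this, hkz]; ring
    have hGy : 0 < G y := by
      have : G y = A - ε * ((y - x) * (z - y)) := by simp only [hG, hA, hY]; ring
      rw [this]; linarith
    have hGt : 0 < G t := hGy.trans_le (hmax ⟨hxy.le, hyz.le⟩)
    have ht' : t ∈ Ioo x z := by
      refine ⟨lt_of_le_of_ne ht.1 ?_, lt_of_le_of_ne ht.2 ?_⟩
      · rintro rfl; linarith
      · rintro rfl; linarith
    have hloc : IsLocalMax G t := by
      filter_upwards [Ioo_mem_nhds ht'.1 ht'.2] with y hy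
      exact hmax ⟨hy.1.le, hy.2.le⟩
    have := hvisc t (hsub ht) _ (fun t => H₁ t + k - ε * ((t - z) + (t - x))) (α t - 2 * ε) ?_ ?_
      hloc
    · linarith
    · filter_upwards [isOpen_Ioo.mem_nhds (hsub ht)] with s hs
      have h1 := ((hd s hs).add ((((hasDerivAt_id s).sub_const x).const_mul k).const_add (Y x))).sub
        ((((hasDerivAt_id s).sub_const x).mul ((hasDerivAt_id s).sub_const z)).const_mul ε)
      refine h1.congr_deriv ?_
      simp
    · have h1 := ((hd1 t (hsub ht)).add_const k).sub
        ((((hasDerivAt_id t).sub_const z).add ((hasDerivAt_id t).sub_const x)).const_mul ε)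
      refine h1.congr_deriv ?_
      ring
  have hint : interior (Ioo l r) = Ioo l r := isOpen_Ioo.interior_eq
  refine ⟨fun t => derivWithin (fun x => V x - H x) (Ioi t) t + H₁ t, hV, fun t ht => ?_,
    fun x hx y hy hxy => ?_⟩
  · have h1 := (hconv.hasDerivWithinAt_rightDeriv_of_mem_interior (hint.symm ▸ ht)).add
      (hd t ht).hasDerivWithinAt
    refine h1.congr_of_eventuallyEq ?_ ?_
    · exact Eventually.of_forall fun z => by simp
    · simp
  · have h1 := hconv.monotoneOn_rightDeriv (hint.symm ▸ hx) (hint.symm ▸ hy) hxy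
    have h2 : (∫ t in x..y, α t) = H₁ y - H₁ x := by
      rw [hH₁]; simp only
      rw [intervalIntegral.integral_interval_sub_left]
      · exact (hα.mono (ordConnected_Ioo.uIcc_subset hm hy)).intervalIntegrable
      · exact (hα.mono (ordConnected_Ioo.uIcc_subset hm hx)).intervalIntegrable
    simp only at h1 ⊢
    linarith

/-- A maximum principle on short intervals, for functions given by their right derivative. -/
theorem le_two_mul_max_of_right_deriv {z π : ℝ → ℝ} {a b K : ℝ} (hab : a ≤ b) (hK : 0 ≤ K)
    (hKab : K * (b - a) ^ 2 ≤ 1 / 4) (hz : ContinuousOn z (Icc a b))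
    (hd : ∀ x ∈ Ico a b, HasDerivWithinAt z (π x) (Ioi x) x) (hb : z b ≤ 0)
    (hπ : ∀ m, ∀ x ∈ Ico a b, ∀ y ∈ Ico a b, x ≤ y → (∀ s ∈ Icc x y, 0 < z s ∧ z s ≤ m) →
      -(K * m * (y - x)) ≤ π y - π x) :
    ∀ t ∈ Icc a b, z t ≤ 2 * max (z a) 0 := by
  intro t ht
  obtain ⟨c, hc, hmax⟩ := isCompact_Icc.exists_isMaxOn ⟨t, ht⟩ hz
  refine le_trans (hmax ht) ?_
  by_contra! hlt
  have hm1 : z a < z c / 2 := by linarith [le_max_left (z a) 0]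
  have hm0 : 0 < z c := by linarith [le_max_right (z a) 0]
  have hcb : c < b := lt_of_le_of_ne hc.2 (by rintro rfl; linarith)
  have hπc : π c ≤ 0 := by
    have h1 := (hd c ⟨hc.1, hcb⟩)
    rw [hasDerivWithinAt_iff_tendsto_slope' self_notMem_Ioi] at h1
    refine le_of_tendsto h1 ?_
    filter_upwards [Ioo_mem_nhdsGT hcb] with y hy
    rw [slope_def_field]
    have : z y ≤ z c := hmax ⟨hc.1.trans hy.1.le, hy.2.le⟩
    exact div_nonpos_of_nonpos_of_nonneg (by linarith) (by linarith [hy.1])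
  have hsub : Icc a c ⊆ Icc a b := Icc_subset_Icc_right hc.2
  set S : Set ℝ := Icc a c ∩ z ⁻¹' Iic (z c / 2) with hS
  have hScl : IsClosed S := (hz.mono hsub).preimage_isClosed_of_isClosed isClosed_Icc isClosed_Iic
  have hSc : IsCompact S := isCompact_Icc.of_isClosed_subset hScl inter_subset_left
  obtain ⟨d, hdS, hdmax⟩ := hSc.exists_isGreatest ⟨a, ⟨le_rfl, hc.1⟩, hm1.le⟩
  have hdz : z d ≤ z c / 2 := hdS.2
  have had : a ≤ d := hdS.1.1
  have hdc : d < c := lt_of_le_of_ne hdS.1.2 (by rintro rfl; linarith)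
  have hgt : ∀ x ∈ Ioc d c, z c / 2 < z x := by
    intro x hx
    by_contra! h
    exact absurd (hdmax ⟨⟨had.trans hx.1.le, hx.2⟩, h⟩) (not_le.mpr hx.1)
  have hzd : z c / 2 ≤ z d := by
    have h1 : Tendsto z (𝓝[>] d) (𝓝 (z d)) := (hd d ⟨had, hdc.trans hcb⟩).continuousWithinAt
    refine ge_of_tendsto h1 ?_
    filter_upwards [Ioo_mem_nhdsGT hdc] with y hy
    exact (hgt y ⟨hy.1, hy.2.le⟩).le
  have hge : ∀ x ∈ Icc d c, 0 < z x ∧ z x ≤ z c := by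
    intro x hx
    refine ⟨?_, hmax ⟨had.trans hx.1, hx.2.trans hc.2⟩⟩
    rcases hx.1.eq_or_lt with h | h
    · rw [← h]; linarith
    · linarith [hgt x ⟨h, hx.2⟩]
  have hπx : ∀ x ∈ Ico d c, π x ≤ K * z c * (b - a) := by
    intro x hx
    have h1 := hπ (z c) x ⟨had.trans hx.1, hx.2.trans hcb⟩ c ⟨hc.1, hcb⟩ hx.2.le
      fun s hs => hge s ⟨hx.1.trans hs.1, hs.2⟩
    have h2 : K * z c * (c - x) ≤ K * z c * (b - a) :=
      mul_le_mul_of_nonneg_left (by linarith [hx.1]) (by positivity)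
    linarith
  have h3 := le_of_right_deriv_nonneg (G := fun x => K * z c * (b - a) * x - z x)
    (g := fun x => K * z c * (b - a) - π x) hdc.le
    ((by fun_prop : Continuous fun x => K * z c * (b - a) * x).continuousOn.sub
      (hz.mono (Icc_subset_Icc had hc.2)))
    (fun x hx => by
      have := ((hasDerivAt_id x).const_mul (K * z c * (b - a))).hasDerivWithinAt (s := Ioi x)
      simpa using this.fun_sub (hd x ⟨had.trans hx.1, hx.2.trans hcb⟩))
    (fun x hx => by linarith [hπx x hx])
  have h4 : K * z c * (b - a) * (c - d) ≤ K * z c * (b - a) * (b - a) :=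
    mul_le_mul_of_nonneg_left (by linarith) (by have : 0 ≤ b - a := by linarith
                                                positivity)
  have h5 : K * z c * (b - a) * (b - a) ≤ z c / 4 := by nlinarith
  linarith

section comparison

variable {V p W q ρ f : ℝ → ℝ} {δ K L : ℝ}

/-- Comparison of a subsolution `V` with time-shifted copies of an increasing blowing-up
supersolution `W`. -/
theorem sub_le_two_mul_max
    (hV : SubPrim V p (fun t => ρ t * f (V t)) (Ioo (-δ) 0))
    (hW : SubPrim (fun t => -W t) (fun t => -q t) (fun t => -(ρ t * f (W t))) (Ioo (-δ) 0))
    (hρc : ContinuousOn ρ (Ioo (-δ) 0)) (hρ0 : ∀ t ∈ Ioo (-δ) 0, 0 ≤ ρ t)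
    (hρ1 : ∀ t ∈ Ioo (-δ) 0, ρ t ≤ 1) (hL : 0 ≤ L)
    (hρL : ∀ x ∈ Ioo (-δ) 0, ∀ y ∈ Ioo (-δ) 0, x ≤ y → ρ y ≤ ρ x * (1 + L * (y - x)))
    (hf : Continuous f) (hK : 0 ≤ K) (hfK : ∀ x y, x ≤ y → f x - f y ≤ K * (y - x))
    (hWm : MonotoneOn W (Ioo (-δ) 0)) (hfW : ∀ t ∈ Ioo (-δ) 0, 0 ≤ f (W t))
    (hWtop : Tendsto W (𝓝[<] 0) atTop) {t₀ : ℝ} (ht₀ : t₀ ∈ Ioo (-δ) 0)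
    (hKt : K * t₀ ^ 2 ≤ 1 / 4) (hLt : 2 * L * (-t₀) ≤ 1) {t : ℝ} (ht : t ∈ Ico t₀ 0) :
    V t - W t ≤ 2 * max (V t₀ - W t₀) 0 := by
  have hWc : ContinuousOn W (Ioo (-δ) 0) := by simpa using hW.cont.fun_neg
  have htI : t ∈ Ioo (-δ) 0 := ⟨ht₀.1.trans_le ht.1, ht.2⟩
  have key : ∀ᶠ h in 𝓝[>] (0:ℝ), V t - W ((1 - 2 * L * h) * t + h) ≤ 2 * max (V t₀ - W t₀) 0 := by
    have e1 : ∀ᶠ h in 𝓝[>] (0:ℝ), 2 * L * h < 1 := by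
      apply eventually_nhdsWithin_of_eventually_nhds
      have : Tendsto (fun h : ℝ => 2 * L * h) (𝓝 0) (𝓝 (2 * L * 0)) :=
        Continuous.tendsto (by fun_prop) _
      exact this.eventually (gt_mem_nhds (by simp))
    have e2 : ∀ᶠ h in 𝓝[>] (0:ℝ), (1 - 2 * L * h) * t + h < 0 := by
      apply eventually_nhdsWithin_of_eventually_nhds
      have : Tendsto (fun h : ℝ => (1 - 2 * L * h) * t + h) (𝓝 0) (𝓝 ((1 - 2 * L * 0) * t + 0)) :=
        Continuous.tendsto (by fun_prop) _
      exact this.eventually (gt_mem_nhds (by simpa using ht.2))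
    filter_upwards [e1, e2, self_mem_nhdsWithin] with h h1 h2 (h3 : 0 < h)
    set c := 1 - 2 * L * h with hc
    have hc0 : 0 < c := by linarith
    set τ : ℝ → ℝ := fun s => c * s + h with hτ
    set t₁ := -h / c with ht₁
    have hτ1 : ∀ s, s < t₁ → τ s < 0 := by
      intro s hs
      rw [ht₁, lt_div_iff₀ hc0] at hs
      simp only [hτ]; linarith
    have htt₁ : t < t₁ := by
      rw [ht₁, lt_div_iff₀ hc0]; linarith
    have ht₁0 : t₁ < 0 := by
      rw [ht₁]; exact div_neg_of_neg_of_pos (by linarith) hc0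
    have hτge : ∀ s, s < t₁ → s ≤ τ s := by
      intro s hs
      have : 0 ≤ L * h * (-s) := by
        have : 0 < -s := by linarith
        positivity
      simp only [hτ, hc]; nlinarith
    have hI : ∀ s, t₀ ≤ s → s < t₁ → s ∈ Ioo (-δ) 0 := fun s h5 h6 =>
      ⟨ht₀.1.trans_le h5, h6.trans ht₁0⟩
    have hτI : ∀ s, t₀ ≤ s → s < t₁ → τ s ∈ Ioo (-δ) 0 := fun s h5 h6 =>
      ⟨ht₀.1.trans_le (h5.trans (hτge s h6)), hτ1 s h6⟩
    have hτmono : StrictMono τ := fun x y hxy => by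
      simp only [hτ]; nlinarith
    have hlim : Tendsto (fun s => V s - W (τ s)) (𝓝[<] t₁) atBot := by
      have hVt : Tendsto V (𝓝[<] t₁) (𝓝 (V t₁)) :=
        ((hV.cont.continuousAt (isOpen_Ioo.mem_nhds ⟨by linarith [htI.1], ht₁0⟩)).tendsto).mono_left
          nhdsWithin_le_nhds
      have hτt : Tendsto τ (𝓝[<] t₁) (𝓝[<] 0) := by
        apply tendsto_nhdsWithin_of_tendsto_nhds_of_eventually_within
        · apply Tendsto.mono_left _ nhdsWithin_le_nhds
          have : τ t₁ = 0 := by simp only [hτ, ht₁]; field_simp; ring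
          rw [← this]
          exact Continuous.tendsto (by fun_prop) _
        · filter_upwards [self_mem_nhdsWithin] with s hs
          exact hτ1 s hs
      have h7 : Tendsto (fun s => -W (τ s)) (𝓝[<] t₁) atBot :=
        tendsto_neg_atTop_atBot.comp (hWtop.comp hτt)
      have := hVt.add_atBot h7
      simpa [sub_eq_add_neg] using this
    obtain ⟨b, hbz, hb⟩ := ((hlim.eventually (eventually_le_atBot 0)).and
      (Ioo_mem_nhdsLT htt₁)).exists
    have hbt₁ : b < t₁ := hb.2
    have ht₀b : t₀ ≤ b := ht.1.trans hb.1.le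
    have hIcc : Icc t₀ b ⊆ Ioo (-δ) 0 := fun s hs => hI s hs.1 (hs.2.trans_lt hbt₁)
    have hzc : ContinuousOn (fun s => V s - W (τ s)) (Icc t₀ b) :=
      (hV.cont.mono hIcc).sub (hWc.comp (by fun_prop : Continuous τ).continuousOn
        fun s hs => hτI s hs.1 (hs.2.trans_lt hbt₁))
    have hWd : ∀ s ∈ Ioo (-δ) 0, HasDerivWithinAt W (q s) (Ioi s) s := fun s hs => by
      simpa using (hW.deriv s hs).fun_neg
    have hmain := le_two_mul_max_of_right_deriv (π := fun s => p s - c * q (τ s)) ht₀b hK ?_ hzc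
      ?_ hbz ?_ t ⟨ht.1, hb.1.le⟩
    · refine hmain.trans ?_
      gcongr
      exact hWm ht₀ (hτI t₀ le_rfl (ht.1.trans_lt htt₁)) (hτge t₀ (ht.1.trans_lt htt₁))
    · refine le_trans ?_ hKt
      have : (b - t₀) ^ 2 ≤ t₀ ^ 2 := by
        have := ht₀.2
        nlinarith
      gcongr
    · intro x hx
      have hx1 : x < t₁ := hx.2.trans hbt₁
      have hτd : HasDerivWithinAt τ c (Ioi x) x := by
        exact ((((hasDerivAt_id x).const_mul c).add_const h).congr_deriv
          (mul_one c)).hasDerivWithinAt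
      have h8 := (hWd (τ x) (hτI x hx.1 hx1)).comp x hτd (fun s hs => hτmono hs)
      have := (hV.deriv x (hI x hx.1 hx1)).fun_sub h8
      rw [mul_comm c]
      exact this
    · intro m x hx y hy hxy hs
      have hx1 : x < t₁ := hx.2.trans hbt₁
      have hy1 : y < t₁ := hy.2.trans hbt₁
      have i1 := hV.incr x (hI x hx.1 hx1) y (hI y hy.1 hy1) hxy
      have i2 := hW.incr (τ x) (hτI x hx.1 hx1) (τ y) (hτI y hy.1 hy1) (hτmono.monotone hxy)
      rw [intervalIntegral.integral_neg] at i2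
      have i3 : c * ∫ s in x..y, ρ (τ s) * f (W (τ s)) = ∫ s in (τ x)..(τ y), ρ s * f (W s) := by
        have := intervalIntegral.integral_comp_mul_add (a := x) (b := y)
          (fun s => ρ s * f (W s)) hc0.ne' h
        simp only [hτ]
        rw [this, smul_eq_mul, ← mul_assoc, mul_inv_cancel₀ hc0.ne', one_mul]
      have i4 : c * (∫ s in (τ x)..(τ y), ρ s * f (W s)) =
          ∫ s in x..y, c * (c * (ρ (τ s) * f (W (τ s)))) := by
        rw [intervalIntegral.integral_const_mul, intervalIntegral.integral_const_mul, i3]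
      have hIxy : uIcc x y ⊆ Ioo (-δ) 0 := by
        rw [uIcc_of_le hxy]
        exact fun s hs => hI s (hx.1.trans hs.1) (hs.2.trans_lt hy1)
      have hτxy : MapsTo τ (uIcc x y) (Ioo (-δ) 0) := by
        rw [uIcc_of_le hxy]
        exact fun s hs => hτI s (hx.1.trans hs.1) (hs.2.trans_lt hy1)
      have c1 : ContinuousOn (fun s => ρ s * f (V s)) (Ioo (-δ) 0) :=
        hρc.mul (hf.comp_continuousOn hV.cont)
      have c2 : ContinuousOn (fun s => ρ s * f (W s)) (Ioo (-δ) 0) :=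
        hρc.mul (hf.comp_continuousOn hWc)
      have c3 : ContinuousOn (fun s => c * (c * (ρ (τ s) * f (W (τ s))))) (uIcc x y) :=
        ((c2.comp (by fun_prop : Continuous τ).continuousOn hτxy).const_smul c).const_smul c
      have i5 : ∫ s in x..y, -(K * m) ≤
          ∫ s in x..y, (ρ s * f (V s) - c * (c * (ρ (τ s) * f (W (τ s))))) := by
        apply intervalIntegral.integral_mono_on hxy (by simp)
        · exact ((c1.mono hIxy).sub c3).intervalIntegrable
        · intro s hs'
          have hsI : s ∈ Ioo (-δ) 0 := hIxy (by rwa [uIcc_of_le hxy])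
          have hst₁ : s < t₁ := hs'.2.trans_lt hy1
          have hτsI : τ s ∈ Ioo (-δ) 0 := hτxy (by rwa [uIcc_of_le hxy])
          obtain ⟨hz0, hzm⟩ := hs s hs'
          have j1 : c * (c * ρ (τ s)) ≤ ρ s := by
            have j2 := hρL s hsI (τ s) hτsI (hτge s hst₁)
            have j3 : τ s - s ≤ 2 * h := by
              have j6 : 2 * L * (-s) ≤ 1 := by
                have : t₀ ≤ s := hx.1.trans hs'.1
                nlinarith
              simp only [hτ, hc]
              nlinarith
            have j4 : ρ (τ s) ≤ ρ s * (1 + L * (2 * h)) := by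
              refine j2.trans ?_
              have := hρ0 s hsI
              gcongr
            have j5 : c * (c * (1 + L * (2 * h))) ≤ 1 := by
              have k1 : c * (1 + L * (2 * h)) ≤ 1 := by
                rw [hc]; nlinarith [sq_nonneg (L * h)]
              have k2 : c ≤ 1 := by rw [hc]; nlinarith
              have k3 : 0 ≤ c * (1 + L * (2 * h)) := by positivity
              nlinarith
            calc c * (c * ρ (τ s)) ≤ c * (c * (ρ s * (1 + L * (2 * h)))) := by gcongr
              _ = ρ s * (c * (c * (1 + L * (2 * h)))) := by ring
              _ ≤ ρ s * 1 := by have := hρ0 s hsI; gcongr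
              _ = ρ s := mul_one _
          have j2 := mul_le_mul_of_nonneg_right j1 (hfW _ hτsI)
          have j3 := hfK (W (τ s)) (V s) (by linarith)
          have j4 : f (W (τ s)) - f (V s) ≤ K * m := by
            refine j3.trans ?_
            gcongr
          have j5 : ρ s * (f (W (τ s)) - f (V s)) ≤ K * m := by
            have k1 := hρ0 s hsI
            have k2 := hρ1 s hsI
            have k3 : 0 ≤ K * m := by
              have : 0 ≤ m := by linarith
              positivity
            calc ρ s * (f (W (τ s)) - f (V s)) ≤ ρ s * (K * m) := by gcongr
              _ ≤ 1 * (K * m) := by gcongr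
              _ = K * m := one_mul _
          linarith
      rw [intervalIntegral.integral_sub (c1.mono hIxy).intervalIntegrable c3.intervalIntegrable,
        ← i4, intervalIntegral.integral_const, smul_eq_mul] at i5
      have i6 := mul_le_mul_of_nonneg_left i2 hc0.le
      linarith
  have hlim : Tendsto (fun h => V t - W ((1 - 2 * L * h) * t + h)) (𝓝[>] 0) (𝓝 (V t - W t)) := by
    apply Tendsto.mono_left _ nhdsWithin_le_nhds
    apply tendsto_const_nhds.sub
    have h1 : Tendsto (fun h : ℝ => (1 - 2 * L * h) * t + h) (𝓝 0) (𝓝 t) := by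
      have : Tendsto (fun h : ℝ => (1 - 2 * L * h) * t + h) (𝓝 0) (𝓝 ((1 - 2 * L * 0) * t + 0)) :=
        Continuous.tendsto (by fun_prop) _
      simpa using this
    exact (hWc.continuousAt (isOpen_Ioo.mem_nhds htI)).tendsto.comp h1
  exact le_of_tendsto hlim key

end comparison

theorem eventually_sub_le_of_right_deriv {g : ℝ → ℝ} {d x ε : ℝ}
    (hg : HasDerivWithinAt g d (Ioi x) x) (hd : 0 ≤ d) (hε : 0 < ε) :
    ∀ᶠ y in 𝓝[>] x, g x - ε * (y - x) ≤ g y := by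
  rw [hasDerivWithinAt_iff_tendsto_slope' self_notMem_Ioi] at hg
  filter_upwards [hg.eventually (lt_mem_nhds (by linarith : -ε < d)), self_mem_nhdsWithin]
    with y hy (hxy : x < y)
  rw [slope_def_field, lt_div_iff₀ (by linarith)] at hy
  linarith

/-- Energy inequality for functions `p`, `q` with `p' ≥ α` and `q' ≤ β` in the integrated sense. -/
theorem energy_le {p q α β Φ φ : ℝ → ℝ} {l r a b : ℝ} (hab : a ≤ b) (hI : Icc a b ⊆ Ioo l r)
    (hα : ContinuousOn α (Ioo l r)) (hβ : ContinuousOn β (Ioo l r))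
    (hα0 : ∀ x ∈ Icc a b, 0 ≤ α x)
    (hp0 : ∀ x ∈ Icc a b, 0 ≤ p x) (hq0 : ∀ x ∈ Icc a b, 0 ≤ q x)
    (hp : ∀ x ∈ Icc a b, ∀ y ∈ Icc a b, x ≤ y → ∫ t in x..y, α t ≤ p y - p x)
    (hq : ∀ x ∈ Icc a b, ∀ y ∈ Icc a b, x ≤ y → q y - q x ≤ ∫ t in x..y, β t)
    (hΦ : ContinuousOn Φ (Icc a b)) (hΦd : ∀ x ∈ Ico a b, HasDerivWithinAt Φ (φ x) (Ioi x) x)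
    (hφ : ∀ x ∈ Ico a b, φ x ≤ 2 * (α x * p x - β x * q x)) :
    Φ b - Φ a ≤ (p b ^ 2 - q b ^ 2) - (p a ^ 2 - q a ^ 2) := by
  have hJ0 : ∀ x ∈ Icc a b, ∀ y ∈ Icc a b, x ≤ y → 0 ≤ ∫ t in x..y, α t := fun x hx y hy hxy =>
    intervalIntegral.integral_nonneg hxy fun u hu => hα0 u ⟨hx.1.trans hu.1, hu.2.trans hy.2⟩
  suffices h : p a ^ 2 - q a ^ 2 - Φ a ≤ p b ^ 2 - q b ^ 2 - Φ b by linarith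
  refine le_of_dini (G := fun x => p x ^ 2 - q x ^ 2 - Φ x) hab ?_ ?_
  · intro c hc
    have hcI : c ∈ Icc a b := ⟨hc.1.le, hc.2⟩
    refine ⟨fun y => p c ^ 2 - (max (q c - ∫ t in y..c, β t) 0) ^ 2 - Φ y, ?_, ?_⟩
    · have h1 : Tendsto (fun y => ∫ t in y..c, β t) (𝓝[<] c) (𝓝 0) := by
        have h2 := (hasDerivAt_primitive hβ (hI hcI) (hI hcI)).continuousAt.tendsto.neg
        simp only [intervalIntegral.integral_same, neg_zero] at h2
        refine (h2.mono_left nhdsWithin_le_nhds).congr fun y => ?_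
        rw [intervalIntegral.integral_symm c y]
      have h3 : Tendsto Φ (𝓝[<] c) (𝓝 (Φ c)) := by
        have := hΦ c hcI
        refine (this.mono_left ?_)
        rw [← nhdsWithin_Ioo_eq_nhdsLT hc.1]
        exact nhdsWithin_mono _ fun y hy => ⟨hy.1.le, hy.2.le.trans hc.2⟩
      have h4 := (tendsto_const_nhds (x := p c ^ 2)).sub
        (((tendsto_const_nhds (x := q c)).sub h1).max (tendsto_const_nhds (x := (0:ℝ))) |>.pow 2)
        |>.sub h3
      simpa [max_eq_left (hq0 c hcI)] using h4
    · filter_upwards [Ioo_mem_nhdsLT hc.1] with y hy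
      have hyI : y ∈ Icc a b := ⟨hy.1.le, hy.2.le.trans hc.2⟩
      have h1 := hp y hyI c hcI hy.2.le
      have h2 := hJ0 y hyI c hcI hy.2.le
      have h3 := hq y hyI c hcI hy.2.le
      have h4 : max (q c - ∫ t in y..c, β t) 0 ≤ q y := max_le (by linarith) (hq0 y hyI)
      have h5 : (max (q c - ∫ t in y..c, β t) 0) ^ 2 ≤ q y ^ 2 :=
        pow_le_pow_left₀ (le_max_right _ _) h4 2
      have h6 : p y ^ 2 ≤ p c ^ 2 := pow_le_pow_left₀ (hp0 y hyI) (by linarith) 2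
      linarith
  · intro x hx ε hε
    have hxI : x ∈ Icc a b := ⟨hx.1, hx.2.le⟩
    have h1 := ((hasDerivAt_primitive hα (hI hxI) (hI hxI)).const_add (p x)).fun_pow 2
    have h2 := ((hasDerivAt_primitive hβ (hI hxI) (hI hxI)).const_add (q x)).fun_pow 2
    have h3 := ((h1.fun_sub h2).hasDerivWithinAt (s := Ioi x)).fun_sub (hΦd x hx)
    simp only [intervalIntegral.integral_same, add_zero] at h3
    have h4 := hφ x hx
    filter_upwards [eventually_sub_le_of_right_deriv h3 (by norm_num; linarith) hε,
      Ioo_mem_nhdsGT hx.2] with y hy hxy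
    have hyI : y ∈ Icc a b := ⟨hx.1.trans hxy.1.le, hxy.2.le⟩
    simp only [intervalIntegral.integral_same, add_zero] at hy
    refine hy.trans ?_
    have h5 := hp x hxI y hyI hxy.1.le
    have h6 := hJ0 x hxI y hyI hxy.1.le
    have h7 := hq x hxI y hyI hxy.1.le
    have h8 : (p x + ∫ t in x..y, α t) ^ 2 ≤ p y ^ 2 :=
      pow_le_pow_left₀ (by linarith [hp0 x hxI]) (by linarith) 2
    have h9 : q y ^ 2 ≤ (q x + ∫ t in x..y, β t) ^ 2 :=
      pow_le_pow_left₀ (hq0 y hyI) (by linarith) 2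
    linarith

section growth

variable {f F : ℝ → ℝ} {a K : ℝ}

theorem hasDerivAt_of_eq_integral (hf : Continuous f) (hF : ∀ t, F t = ∫ s in a..t, f s) (t : ℝ) :
    HasDerivAt F (f t) t := by
  rw [show F = fun t => ∫ s in a..t, f s from funext hF]
  exact intervalIntegral.integral_hasDerivAt_right (hf.intervalIntegrable _ _)
    (hf.stronglyMeasurableAtFilter _ _) hf.continuousAt

theorem monotoneOn_primitive (hf : Continuous f) (hF : ∀ t, F t = ∫ s in a..t, f s)
    (hfpos : ∀ t, a < t → 0 ≤ f t) : MonotoneOn F (Ici a) := by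
  apply monotoneOn_of_deriv_nonneg (convex_Ici a)
    (fun t _ => (hasDerivAt_of_eq_integral hf hF t).continuousAt.continuousWithinAt)
    (fun t _ => (hasDerivAt_of_eq_integral hf hF t).differentiableAt.differentiableWithinAt)
  intro t ht
  rw [(hasDerivAt_of_eq_integral hf hF t).deriv]
  rw [interior_Ici] at ht
  exact hfpos t ht

theorem primitive_pos (hf : Continuous f) (hF : ∀ t, F t = ∫ s in a..t, f s)
    (ha : 0 < f a) (hfpos : ∀ t, a < t → 0 ≤ f t) {t : ℝ} (ht : a < t) : 0 < F t := by
  rw [hF]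
  apply intervalIntegral.integral_pos ht hf.continuousOn fun x hx => hfpos x hx.1
  exact ⟨a, ⟨le_rfl, ht.le⟩, ha⟩

theorem tendsto_integral_inv_sqrt (hKO : ∃ M, a < M ∧
    IntegrableOn (fun t => 1 / Real.sqrt (F t)) (Ici M)) :
    ∃ M l, a < M ∧ Tendsto (fun v => ∫ t in M..v, 1 / Real.sqrt (F t)) atTop (𝓝 l) := by
  obtain ⟨M, hM, hint⟩ := hKO
  exact ⟨M, _, hM, intervalIntegral_tendsto_integral_Ioi M (hint.mono_set Ioi_subset_Ici_self)
    tendsto_id⟩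

theorem hasDerivAt_integral_inv_sqrt (hf : Continuous f) (hF : ∀ t, F t = ∫ s in a..t, f s)
    (ha : 0 < f a) (hfpos : ∀ t, a < t → 0 ≤ f t) {M v : ℝ} (hM : a < M) (hv : a < v) :
    HasDerivAt (fun v => ∫ t in M..v, 1 / Real.sqrt (F t)) (1 / Real.sqrt (F v)) v := by
  have hc : ContinuousOn (fun t => 1 / Real.sqrt (F t)) (Ioo a (max M v + 1)) := by
    have hFc : Continuous F := continuous_iff_continuousAt.mpr fun t =>
      (hasDerivAt_of_eq_integral hf hF t).continuousAt
    apply continuousOn_const.div (Real.continuous_sqrt.comp hFc).continuousOn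
    intro t ht
    exact (Real.sqrt_pos.mpr (primitive_pos hf hF ha hfpos ht.1)).ne'
  exact hasDerivAt_primitive hc ⟨hM, by linarith [le_max_left M v]⟩
    ⟨hv, by linarith [le_max_right M v]⟩

theorem div_sqrt_le_integral_inv_sqrt (hf : Continuous f) (hF : ∀ t, F t = ∫ s in a..t, f s)
    (ha : 0 < f a) (hfpos : ∀ t, a < t → 0 ≤ f t) {M v w : ℝ} (hM : a < M) (hv : a < v)
    (hvw : v < w) : (w - v) / Real.sqrt (F w) ≤
      (∫ t in M..w, 1 / Real.sqrt (F t)) - ∫ t in M..v, 1 / Real.sqrt (F t) := by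
  have hd : ∀ x ∈ Icc v w, HasDerivAt (fun v => ∫ t in M..v, 1 / Real.sqrt (F t))
      (1 / Real.sqrt (F x)) x := fun x hx =>
    hasDerivAt_integral_inv_sqrt hf hF ha hfpos hM (hv.trans_le hx.1)
  obtain ⟨c, hc, hcs⟩ := exists_hasDerivAt_eq_slope _ _ hvw
    (fun x hx => (hd x hx).continuousAt.continuousWithinAt) (fun x hx => hd x ⟨hx.1.le, hx.2.le⟩)
  rw [eq_div_iff (by linarith)] at hcs
  rw [← hcs, one_div_mul_eq_div]
  have h1 : 0 < F c := primitive_pos hf hF ha hfpos (hv.trans hc.1)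
  have h2 : F c ≤ F w := monotoneOn_primitive hf hF hfpos (hv.trans hc.1).le
    ((hv.trans hvw).le) hc.2.le
  have h3 : 0 < Real.sqrt (F c) := Real.sqrt_pos.mpr h1
  have h4 : 0 ≤ w - v := by linarith
  gcongr

theorem eventually_mul_sq_le_primitive (hf : Continuous f) (hF : ∀ t, F t = ∫ s in a..t, f s)
    (ha : 0 < f a) (hfpos : ∀ t, a < t → 0 ≤ f t)
    (hKO : ∃ M, a < M ∧ IntegrableOn (fun t => 1 / Real.sqrt (F t)) (Ici M)) (B : ℝ) :
    ∀ᶠ v in atTop, B * v ^ 2 ≤ F v := by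
  obtain ⟨M, l, hM, hl⟩ := tendsto_integral_inv_sqrt hKO
  have h1 : Tendsto (fun v : ℝ => v / 2) atTop atTop := tendsto_id.atTop_div_const (by norm_num)
  have h2 := hl.sub (hl.comp h1)
  rw [sub_self] at h2
  set C := |B| + 1 with hC
  have hCpos : 0 < C := by positivity
  filter_upwards [h2.eventually (gt_mem_nhds (by positivity : 0 < 1 / (2 * C))),
    h1.eventually (eventually_gt_atTop a), eventually_gt_atTop 0] with v hv1 hv2 hv3
  have h3 := div_sqrt_le_integral_inv_sqrt hf hF ha hfpos hM hv2 (by linarith : v / 2 < v)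
  have h4 : 0 < F v := primitive_pos hf hF ha hfpos (by linarith)
  have h5 := Real.sqrt_pos.mpr h4
  have h6 := h3.trans_lt hv1
  rw [div_lt_div_iff₀ h5 (by positivity)] at h6
  have h7 : C * v ≤ Real.sqrt (F v) := by linarith
  have h8 : (C * v) ^ 2 ≤ F v := by
    calc (C * v) ^ 2 ≤ Real.sqrt (F v) ^ 2 := pow_le_pow_left₀ (by positivity) h7 2
      _ = F v := Real.sq_sqrt h4.le
  have h9 : B ≤ C ^ 2 := by nlinarith [le_abs_self B, abs_nonneg B]
  nlinarith [sq_nonneg v]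

theorem primitive_le_mul (hf : Continuous f) (hF : ∀ t, F t = ∫ s in a..t, f s) (hK : 0 ≤ K)
    (hfK : ∀ x y, x ≤ y → f x - f y ≤ K * (y - x)) {v : ℝ} (hv : a ≤ v) :
    F v ≤ (v - a) * (f v + K * (v - a)) := by
  rw [hF]
  have : ∫ s in a..v, f s ≤ ∫ _ in a..v, (f v + K * (v - a)) := by
    apply intervalIntegral.integral_mono_on hv (hf.intervalIntegrable _ _) (by simp)
    intro s hs
    have := hfK s v hs.2
    have : K * (v - s) ≤ K * (v - a) := by
      have := hs.1
      gcongr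
    linarith
  rwa [intervalIntegral.integral_const, smul_eq_mul] at this

theorem eventually_mul_le (hf : Continuous f) (hF : ∀ t, F t = ∫ s in a..t, f s)
    (ha : 0 < f a) (hfpos : ∀ t, a < t → 0 ≤ f t)
    (hKO : ∃ M, a < M ∧ IntegrableOn (fun t => 1 / Real.sqrt (F t)) (Ici M))
    (hK : 0 ≤ K) (hfK : ∀ x y, x ≤ y → f x - f y ≤ K * (y - x)) (B : ℝ) :
    ∀ᶠ v in atTop, B * v ≤ f v := by
  filter_upwards [eventually_mul_sq_le_primitive hf hF ha hfpos hKO (2 * (|B| + 2 * K)),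
    eventually_gt_atTop |a|, eventually_gt_atTop 0] with v h1 h2 h3
  have h4 : a < v := (le_abs_self a).trans_lt h2
  have h5 := primitive_le_mul hf hF hK hfK h4.le
  have h6 : v - a ≤ 2 * v := by linarith [neg_abs_le a]
  have h7 : 0 ≤ f v := hfpos v h4
  have h8 : (v - a) * (f v + K * (v - a)) ≤ (2 * v) * (f v + K * (2 * v)) := by
    have : 0 ≤ v - a := by linarith
    gcongr
  have h9 : v * (|B| * v) ≤ v * f v := by nlinarith
  have := le_of_mul_le_mul_left h9 h3
  nlinarith [le_abs_self B]

theorem eventually_mul_sqrt_le (hf : Continuous f) (hF : ∀ t, F t = ∫ s in a..t, f s)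
    (ha : 0 < f a) (hfpos : ∀ t, a < t → 0 ≤ f t)
    (hKO : ∃ M, a < M ∧ IntegrableOn (fun t => 1 / Real.sqrt (F t)) (Ici M))
    (hK : 0 ≤ K) (hfK : ∀ x y, x ≤ y → f x - f y ≤ K * (y - x)) {B : ℝ} :
    ∀ᶠ v in atTop, B * Real.sqrt (F v) ≤ f v := by
  filter_upwards [eventually_mul_le hf hF ha hfpos hKO hK hfK (2 * K + 4 * B ^ 2),
    eventually_gt_atTop |a|, eventually_gt_atTop 0] with v h1 h2 h3
  have h4 : a < v := (le_abs_self a).trans_lt h2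
  have h5 := primitive_le_mul hf hF hK hfK h4.le
  have h6 : v - a ≤ 2 * v := by linarith [neg_abs_le a]
  have h7 : 0 ≤ f v := hfpos v h4
  have h8 : (v - a) * (f v + K * (v - a)) ≤ (2 * v) * (f v + K * (2 * v)) := by
    have : 0 ≤ v - a := by linarith
    gcongr
  have h9 : 2 * K * v ≤ f v := by nlinarith [sq_nonneg B]
  have h10 : F v ≤ 4 * v * f v := by nlinarith
  have h11 : 4 * B ^ 2 * v ≤ f v := by nlinarith
  have h12 : (B * Real.sqrt (F v)) ^ 2 ≤ f v ^ 2 := by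
    rw [mul_pow, Real.sq_sqrt (primitive_pos hf hF ha hfpos h4).le]
    calc B ^ 2 * F v ≤ B ^ 2 * (4 * v * f v) := by gcongr
      _ = (4 * B ^ 2 * v) * f v := by ring
      _ ≤ f v * f v := by gcongr
      _ = f v ^ 2 := by ring
  exact le_of_sq_le_sq h12 h7

end growth

theorem neg_le_div_sub_div {S T p q ε : ℝ} (hT : 0 < T) (hTS : T ≤ S) (hq : 0 ≤ q) (hpq : q < p)
    (hε : 0 < ε) (hε' : ε ≤ 1 / 8) (h1 : q ^ 2 ≤ 2 * (1 + ε) * T ^ 2)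
    (h2 : 2 * (1 - 2 * ε) * (S ^ 2 - T ^ 2) ≤ p ^ 2 - q ^ 2) :
    -(30 * ε / S * (p - q)) ≤ p / S - q / T := by
  have hS : 0 < S := hT.trans_le hTS
  by_contra! hlt
  set x := p / S with hx
  set y := q / T with hy
  have hpx : p = x * S := by rw [hx, div_mul_cancel₀ _ hS.ne']
  have hqy : q = y * T := by rw [hy, div_mul_cancel₀ _ hT.ne']
  have hx0 : 0 ≤ x := div_nonneg (by linarith) hS.le
  have hy0 : 0 ≤ y := div_nonneg hq hT.le
  have hΓ0 : 0 ≤ S ^ 2 - T ^ 2 := by nlinarith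
  have hxy : x < y := by
    have : 0 ≤ 30 * ε / S * (p - q) := mul_nonneg (by positivity) (by linarith)
    linarith
  have hy2 : y ^ 2 ≤ 2 * (1 + ε) := by
    rw [hqy, mul_pow] at h1
    exact le_of_mul_le_mul_right h1 (by positivity)
  have h3 : (y ^ 2 - x ^ 2) * S ^ 2 ≤ (S ^ 2 - T ^ 2) * (y ^ 2 - 2 + 4 * ε) := by
    have e1 : p ^ 2 = x ^ 2 * S ^ 2 := by rw [hpx]; ring
    have e2 : q ^ 2 = y ^ 2 * T ^ 2 := by rw [hqy]; ring
    rw [e1, e2] at h2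
    linarith
  have hy1 : 1 ≤ y := by
    by_contra! hy1
    have e1 : 0 < (y ^ 2 - x ^ 2) * S ^ 2 := mul_pos (by nlinarith) (by positivity)
    have e2 : y ^ 2 - 2 + 4 * ε ≤ 0 := by nlinarith
    nlinarith
  have h4 : (y - x) * S ^ 2 ≤ (S ^ 2 - T ^ 2) * (6 * ε) := by
    have e1 : (S ^ 2 - T ^ 2) * (y ^ 2 - 2 + 4 * ε) ≤ (S ^ 2 - T ^ 2) * (6 * ε) := by
      gcongr; linarith
    have e2 : (y - x) * S ^ 2 ≤ (y ^ 2 - x ^ 2) * S ^ 2 := by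
      apply mul_le_mul_of_nonneg_right _ (by positivity)
      nlinarith
    linarith
  have hqS : q ≤ 2 * S := by
    have : y ≤ 2 := by nlinarith
    rw [hqy]
    nlinarith
  have hΓ : S ^ 2 - T ^ 2 ≤ 5 * S * (p - q) := by
    rcases le_or_gt S (p - q) with h | h
    · nlinarith
    · have e1 : S ^ 2 - T ^ 2 ≤ p ^ 2 - q ^ 2 := by nlinarith
      have e2 : p ^ 2 - q ^ 2 = (p - q) * ((p - q) + 2 * q) := by ring
      have e3 : (p - q) * ((p - q) + 2 * q) ≤ (p - q) * (5 * S) := by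
        apply mul_le_mul_of_nonneg_left _ (by linarith)
        linarith
      linarith
  have h5 : (y - x) * S ^ 2 ≤ 30 * ε / S * (p - q) * S ^ 2 := by
    have e1 : 30 * ε / S * (p - q) * S ^ 2 = (5 * S * (p - q)) * (6 * ε) := by
      field_simp; ring
    rw [e1]
    refine h4.trans ?_
    gcongr
  have h6 := le_of_mul_le_mul_right h5 (by positivity)
  linarith

theorem SubPrim.mono {V p α : ℝ → ℝ} {s t : Set ℝ} (h : SubPrim V p α t) (hst : s ⊆ t) :
    SubPrim V p α s :=
  ⟨h.cont.mono hst, fun x hx => h.deriv x (hst hx),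
    fun x hx y hy hxy => h.incr x (hst hx) y (hst hy) hxy⟩

theorem right_deriv_nonneg_of_monotoneOn {W : ℝ → ℝ} {d l r t : ℝ} (hW : MonotoneOn W (Ioo l r))
    (ht : t ∈ Ioo l r) (hd : HasDerivWithinAt W d (Ioi t) t) : 0 ≤ d := by
  rw [hasDerivWithinAt_iff_tendsto_slope' self_notMem_Ioi] at hd
  refine ge_of_tendsto hd ?_
  filter_upwards [Ioo_mem_nhdsGT ht.2] with y hy
  rw [slope_def_field]
  have := hW ht ⟨ht.1.trans hy.1, hy.2⟩ hy.1.le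
  exact div_nonneg (by linarith) (by linarith [hy.1])

theorem exists_Ico_of_eventually {P : ℝ → Prop} {l : ℝ} (hl : l < 0) (h : ∀ᶠ t in 𝓝[<] 0, P t) :
    ∃ m ∈ Ioo l 0, ∀ t ∈ Ico m 0, P t := by
  obtain ⟨m, hm, hP⟩ := (mem_nhdsLT_iff_exists_Ico_subset).mp
    (Filter.inter_mem h (Ioo_mem_nhdsLT hl))
  exact ⟨m, (hP ⟨le_rfl, hm⟩).2, fun t ht => (hP ht).1⟩

section comparison

variable {V p W q ρ f F : ℝ → ℝ} {a l K L M : ℝ}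

theorem false_of_one_le_sub (hl : l < 0)
    (hV : SubPrim V p (fun t => ρ t * f (V t)) (Ioo l 0))
    (hW : SubPrim (fun t => -W t) (fun t => -q t) (fun t => -(ρ t * f (W t))) (Ioo l 0))
    (hρc : ContinuousOn ρ (Ioo l 0)) (hρ0 : ∀ t ∈ Ioo l 0, 0 ≤ ρ t)
    (hρ1 : ∀ t ∈ Ioo l 0, ρ t ≤ 1) (hρt : Tendsto ρ (𝓝[<] 0) (𝓝 1))
    (hf : Continuous f) (hF : ∀ t, F t = ∫ s in a..t, f s) (ha : 0 < f a)
    (hfpos : ∀ t, a < t → 0 ≤ f t)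
    (hKO : ∃ M, a < M ∧ IntegrableOn (fun t => 1 / Real.sqrt (F t)) (Ici M))
    (hK : 0 ≤ K) (hfK : ∀ x y, x ≤ y → f x - f y ≤ K * (y - x))
    (hWm : MonotoneOn W (Ioo l 0)) (haW : ∀ t ∈ Ioo l 0, a < W t)
    (hWV : ∀ t ∈ Ioo l 0, W t ≤ V t) (hWtop : Tendsto W (𝓝[<] 0) atTop)
    (hM : ∀ t ∈ Ioo l 0, V t - W t ≤ M) (hpq : ∀ t ∈ Ioo l 0, 1 ≤ p t - q t) : False := by
  have hWc : ContinuousOn W (Ioo l 0) := by simpa using hW.cont.fun_neg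
  have hWd : ∀ s ∈ Ioo l 0, HasDerivWithinAt W (q s) (Ioi s) s := fun s hs => by
    simpa using (hW.deriv s hs).fun_neg
  have hq0 : ∀ t ∈ Ioo l 0, 0 ≤ q t := fun t ht =>
    right_deriv_nonneg_of_monotoneOn hWm ht (hWd t ht)
  have hp0 : ∀ t ∈ Ioo l 0, 0 ≤ p t := fun t ht => by linarith [hq0 t ht, hpq t ht]
  have haV : ∀ t ∈ Ioo l 0, a < V t := fun t ht => (haW t ht).trans_le (hWV t ht)
  have hIcc : ∀ {x y}, x ∈ Ioo l 0 → y ∈ Ioo l 0 → Icc x y ⊆ Ioo l 0 := fun hx hy s hs =>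
    ⟨hx.1.trans_le hs.1, hs.2.trans_lt hy.2⟩
  have hVm : MonotoneOn V (Ioo l 0) := fun x hx y hy hxy =>
    le_of_right_deriv_nonneg hxy (hV.cont.mono (hIcc hx hy))
      (fun s hs => hV.deriv s (hIcc hx hy ⟨hs.1, hs.2.le⟩))
      (fun s hs => hp0 s (hIcc hx hy ⟨hs.1, hs.2.le⟩))
  have hVtop : Tendsto V (𝓝[<] 0) atTop := tendsto_atTop_mono' _
    (by filter_upwards [Ioo_mem_nhdsLT hl] with t ht using hWV t ht) hWtop
  have hFd := hasDerivAt_of_eq_integral hf hF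
  have hFpos : ∀ {t}, a < t → 0 < F t := fun ht => primitive_pos hf hF ha hfpos ht
  have hFm := monotoneOn_primitive hf hF hfpos
  have hFc : Continuous F := continuous_iff_continuousAt.mpr fun t => (hFd t).continuousAt
  have hβ : ContinuousOn (fun t => ρ t * f (W t)) (Ioo l 0) := hρc.mul (hf.comp_continuousOn hWc)
  have hα : ContinuousOn (fun t => ρ t * f (V t)) (Ioo l 0) :=
    hρc.mul (hf.comp_continuousOn hV.cont)
  have hqβ : ∀ x ∈ Ioo l 0, ∀ y ∈ Ioo l 0, x ≤ y → q y - q x ≤ ∫ t in x..y, ρ t * f (W t) := by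
    intro x hx y hy hxy
    have := hW.incr x hx y hy hxy
    rw [intervalIntegral.integral_neg] at this
    linarith
  have hFWd : ∀ s ∈ Ioo l 0, HasDerivWithinAt (fun t => F (W t)) (f (W s) * q s) (Ioi s) s :=
    fun s hs => (hFd (W s)).comp_hasDerivWithinAt s (hWd s hs)
  have hFVd : ∀ s ∈ Ioo l 0, HasDerivWithinAt (fun t => F (V t)) (f (V s) * p s) (Ioi s) s :=
    fun s hs => (hFd (V s)).comp_hasDerivWithinAt s (hV.deriv s hs)
  have hFWc : ContinuousOn (fun t => F (W t)) (Ioo l 0) := hFc.comp_continuousOn hWc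
  have hFVc : ContinuousOn (fun t => F (V t)) (Ioo l 0) := hFc.comp_continuousOn hV.cont
  -- lower bound for the gap
  obtain ⟨d, hd0, m₁, hm₁, hgap⟩ : ∃ d > 0, ∃ m₁ ∈ Ioo l 0, ∀ t ∈ Ico m₁ 0, d ≤ V t - W t := by
    have hl2 : l / 2 ∈ Ioo l 0 := ⟨by linarith, by linarith⟩
    refine ⟨-l / 4, by linarith, l / 4, ⟨by linarith, by linarith⟩, fun t ht => ?_⟩
    have htI : t ∈ Ioo l 0 := ⟨by linarith [ht.1], ht.2⟩
    have h1 := le_of_right_deriv_nonneg (G := fun s => V s - W s - s) (g := fun s => p s - q s - 1)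
      (by linarith [ht.1] : l / 2 ≤ t)
      (((hV.cont.sub hWc).sub continuousOn_id).mono (hIcc hl2 htI))
      (fun s hs => by
        have hsI := hIcc hl2 htI ⟨hs.1, hs.2.le⟩
        exact ((hV.deriv s hsI).fun_sub (hWd s hsI)).fun_sub (hasDerivWithinAt_id s _))
      (fun s hs => by linarith [hpq s (hIcc hl2 htI ⟨hs.1, hs.2.le⟩)])
    have h2 := hWV _ hl2
    linarith [ht.1]
  have hsub₁ : Ico m₁ 0 ⊆ Ioo l 0 := fun t ht => ⟨hm₁.1.trans_le ht.1, ht.2⟩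
  have hm₁m : m₁ ∈ Ico m₁ 0 := ⟨le_rfl, hm₁.2⟩
  have hM0 : 0 ≤ M := by linarith [hM m₁ hm₁, hgap m₁ hm₁m]
  set ε := min (1 / 8) (d / (60 * (M + 1))) with hε
  have hε0 : 0 < ε := lt_min (by norm_num) (by positivity)
  have hε8 : ε ≤ 1 / 8 := min_le_left _ _
  have hεM : 30 * ε * M < d := by
    have h1 : ε ≤ d / (60 * (M + 1)) := min_le_right _ _
    rw [le_div_iff₀ (by positivity)] at h1
    nlinarith
  have hev₁ : ∀ᶠ t in 𝓝[<] 0, t ∈ Ico m₁ 0 := Ico_mem_nhdsLT hm₁.2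
  have hFtop : Tendsto F atTop atTop := by
    refine tendsto_atTop_mono' _ (eventually_mul_sq_le_primitive hf hF ha hfpos hKO 1) ?_
    simp only [one_mul]
    exact tendsto_pow_atTop (α := ℝ) two_ne_zero
  -- energy bound for `W`
  obtain ⟨C₁, hC₁⟩ : ∃ C₁, ∀ t ∈ Ico m₁ 0, q t ^ 2 ≤ 2 * F (W t) + C₁ := by
    refine ⟨q m₁ ^ 2 - 2 * F (W m₁), fun t ht => ?_⟩
    have hI := hIcc hm₁ (hsub₁ ht)
    have := energy_le (p := fun _ => 0) (q := q) (α := fun _ => 0) (β := fun t => ρ t * f (W t))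
      (Φ := fun t => -2 * F (W t)) (φ := fun t => -2 * (f (W t) * q t)) ht.1 hI
      continuousOn_const hβ (by simp) (by simp) (fun x hx => hq0 x (hI hx)) (by simp)
      (fun x hx y hy hxy => hqβ x (hI hx) y (hI hy) hxy)
      ((hFWc.mono hI).const_smul (-2 : ℝ))
      (fun x hx => (hFWd x (hI ⟨hx.1, hx.2.le⟩)).const_mul (-2))
      (fun x hx => by
        have hx' := hI ⟨hx.1, hx.2.le⟩
        have h1 : 0 ≤ f (W x) * q x := mul_nonneg (hfpos _ (haW x hx')) (hq0 x hx')
        have h2 := hρ1 x hx'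
        nlinarith)
    linarith
  have hev₂ : ∀ᶠ t in 𝓝[<] 0, |C₁| / (2 * ε) + |C₁| ≤ F (W t) :=
    (hFtop.comp hWtop).eventually (eventually_ge_atTop _)
  have hev₃ : ∀ᶠ t in 𝓝[<] 0, K * M * 2 * Real.sqrt (F (V t)) ≤ f (V t) :=
    hVtop.eventually (eventually_mul_sqrt_le hf hF ha hfpos hKO hK hfK)
  have hev₄ : ∀ᶠ t in 𝓝[<] 0, 1 - ε ≤ ρ t :=
    (hρt.eventually (lt_mem_nhds (by linarith : 1 - ε < 1))).mono fun _ => le_of_lt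
  have hFWV : ∀ t ∈ Ioo l 0, F (W t) ≤ F (V t) := fun t ht =>
    hFm (haW t ht).le (haV t ht).le (hWV t ht)
  obtain ⟨m₂, hm₂, hm₂P⟩ := exists_Ico_of_eventually hm₁.2 (hev₂.and (hev₃.and hev₄))
  have hsub₂ : Ico m₂ 0 ⊆ Ico m₁ 0 := Ico_subset_Ico_left hm₂.1.le
  have hm₂m : m₂ ∈ Ico m₂ 0 := ⟨le_rfl, hm₂.2⟩
  have hqW : ∀ t ∈ Ico m₂ 0, q t ^ 2 ≤ 2 * (1 + ε) * F (W t) := by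
    intro t ht
    have h1 := hC₁ t (hsub₂ ht)
    have h2 : |C₁| / (2 * ε) ≤ F (W t) := by linarith [(hm₂P t ht).1, abs_nonneg C₁]
    rw [div_le_iff₀ (by positivity)] at h2
    linarith [le_abs_self C₁]
  have hpos : ∀ t ∈ Ico m₂ 0, 0 ≤ f (V t) * p t - f (W t) * q t := by
    intro t ht
    have htI := hsub₁ (hsub₂ ht)
    have h1 := hC₁ t (hsub₂ ht)
    have h2 : |C₁| ≤ F (W t) := by
      have : 0 ≤ |C₁| / (2 * ε) := by positivity
      linarith [(hm₂P t ht).1]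
    have h3 : q t ≤ 2 * Real.sqrt (F (V t)) := by
      apply abs_le_of_sq_le_sq' _ (by positivity) |>.2
      rw [mul_pow, Real.sq_sqrt (hFpos (haV t htI)).le]
      linarith [le_abs_self C₁, hFWV t htI, hFpos (haV t htI)]
    have h4 := hfK (W t) (V t) (hWV t htI)
    have h5 : K * (V t - W t) ≤ K * M := mul_le_mul_of_nonneg_left (hM t htI) hK
    have h6 := (hm₂P t ht).2.1
    have h7 := hq0 t htI
    have h8 : (f (W t) - f (V t)) * q t ≤ K * M * (2 * Real.sqrt (F (V t))) :=
      (mul_le_mul_of_nonneg_right (h4.trans h5) h7).trans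
        (mul_le_mul_of_nonneg_left h3 (by positivity))
    have h9 : f (V t) ≤ f (V t) * (p t - q t) :=
      le_mul_of_one_le_right (hfpos _ (haV t htI)) (hpq t htI)
    nlinarith
  obtain ⟨C₃, hC₃⟩ : ∃ C₃, ∀ t ∈ Ico m₂ 0,
      2 * (1 - ε) * (F (V t) - F (W t)) - C₃ ≤ p t ^ 2 - q t ^ 2 := by
    refine ⟨2 * (1 - ε) * (F (V m₂) - F (W m₂)) - (p m₂ ^ 2 - q m₂ ^ 2), fun t ht => ?_⟩
    have hI := hIcc (hsub₁ (hsub₂ hm₂m)) (hsub₁ (hsub₂ ht))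
    have := energy_le (p := p) (q := q) (α := fun t => ρ t * f (V t)) (β := fun t => ρ t * f (W t))
      (Φ := fun t => 2 * (1 - ε) * (F (V t) - F (W t)))
      (φ := fun t => 2 * (1 - ε) * (f (V t) * p t - f (W t) * q t)) ht.1 hI
      hα hβ (fun x hx => mul_nonneg (hρ0 x (hI hx)) (hfpos _ (haV x (hI hx))))
      (fun x hx => hp0 x (hI hx)) (fun x hx => hq0 x (hI hx))
      (fun x hx y hy hxy => hV.incr x (hI hx) y (hI hy) hxy)
      (fun x hx y hy hxy => hqβ x (hI hx) y (hI hy) hxy)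
      (((hFVc.sub hFWc).mono hI).const_smul (2 * (1 - ε)))
      (fun x hx => ((hFVd x (hI ⟨hx.1, hx.2.le⟩)).fun_sub
        (hFWd x (hI ⟨hx.1, hx.2.le⟩))).const_mul (2 * (1 - ε)))
      (fun x hx => by
        have hx2 : x ∈ Ico m₂ 0 := ⟨hx.1, hx.2.trans ht.2⟩
        have h1 := hpos x hx2
        have h2 := (hm₂P x hx2).2.2
        nlinarith [mul_le_mul_of_nonneg_right h2 h1])
    linarith
  have hev₅ : ∀ᶠ t in 𝓝[<] 0, C₃ ≤ 2 * ε * (F (V t) - F (W t)) := by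
    have h1 : ∀ᶠ x in atTop, |C₃| / (2 * ε * d) ≤ f x := by
      filter_upwards [eventually_mul_le hf hF ha hfpos hKO hK hfK 1,
        eventually_ge_atTop (|C₃| / (2 * ε * d))] with x h1 h2
      linarith
    obtain ⟨x₀, hx₀⟩ := eventually_atTop.mp h1
    filter_upwards [hWtop.eventually (eventually_ge_atTop x₀), hev₁] with t ht ht1
    have hg := hgap t ht1
    obtain ⟨c, hc, hcs⟩ := exists_hasDerivAt_eq_slope F f (by linarith : W t < V t)
      hFc.continuousOn fun x _ => hFd x
    rw [eq_div_iff (by linarith)] at hcs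
    have h2 := hx₀ c (ht.trans hc.1.le)
    rw [div_le_iff₀ (by positivity)] at h2
    have h3 : 0 ≤ f c := le_trans (by positivity) (hx₀ c (ht.trans hc.1.le))
    rw [← hcs]
    have h4 : f c * (2 * ε * d) ≤ f c * (2 * ε * (V t - W t)) := by gcongr
    linarith [le_abs_self C₃]
  obtain ⟨m, hm, hmP⟩ := exists_Ico_of_eventually hm₂.2 hev₅
  have hsub : Ico m 0 ⊆ Ico m₂ 0 := Ico_subset_Ico_left hm.1.le
  have hsubI : Ico m 0 ⊆ Ioo l 0 := hsub.trans (hsub₂.trans hsub₁)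
  have hmm : m ∈ Ico m 0 := ⟨le_rfl, hm.2⟩
  have hmI := hsubI hmm
  have hmain : ∀ t ∈ Ico m 0, -(30 * ε / Real.sqrt (F (V t)) * (p t - q t)) ≤
      p t / Real.sqrt (F (V t)) - q t / Real.sqrt (F (W t)) := by
    intro t ht
    have htI := hsubI ht
    have h1 := hFpos (haW t htI)
    refine neg_le_div_sub_div (Real.sqrt_pos.mpr h1) (Real.sqrt_le_sqrt (hFWV t htI))
      (hq0 t htI) (by linarith [hpq t htI]) hε0 hε8 ?_ ?_
    · rw [Real.sq_sqrt h1.le]; exact hqW t (hsub ht)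
    · rw [Real.sq_sqrt h1.le, Real.sq_sqrt (hFpos (haV t htI)).le]
      linarith [hC₃ t (hsub ht), hmP t ht]
  obtain ⟨Y, c, hY, hlim⟩ := tendsto_integral_inv_sqrt hKO
  set Ψ : ℝ → ℝ := fun v => ∫ t in Y..v, 1 / Real.sqrt (F t) with hΨ
  have hΨd : ∀ v, a < v → HasDerivAt Ψ (1 / Real.sqrt (F v)) v := fun v hv =>
    hasDerivAt_integral_inv_sqrt hf hF ha hfpos hY hv
  set σ := Real.sqrt (F (V m)) with hσ
  have hσ0 : 0 < σ := Real.sqrt_pos.mpr (hFpos (haV m hmI))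
  have hle : ∀ b ∈ Ico m 0, Ψ (V m) - Ψ (W m) ≤ Ψ (V b) - Ψ (W b) + 30 * ε / σ * M := by
    intro b hb
    have hI := hIcc hmI (hsubI hb)
    have hIm : ∀ {s}, s ∈ Ico m b → s ∈ Ico m 0 := fun hs => ⟨hs.1, hs.2.trans hb.2⟩
    have h1 := le_of_right_deriv_nonneg
      (G := fun s => Ψ (V s) - Ψ (W s) + 30 * ε / σ * (V s - W s))
      (g := fun s => 1 / Real.sqrt (F (V s)) * p s - 1 / Real.sqrt (F (W s)) * q s
        + 30 * ε / σ * (p s - q s)) hb.1 ?_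
      (fun s hs => by
        have hsI := hsubI (hIm hs)
        exact (((hΨd _ (haV s hsI)).comp_hasDerivWithinAt s (hV.deriv s hsI)).fun_sub
          ((hΨd _ (haW s hsI)).comp_hasDerivWithinAt s (hWd s hsI))).fun_add
          (((hV.deriv s hsI).fun_sub (hWd s hsI)).const_mul _))
      (fun s hs => by
        have hsI := hsubI (hIm hs)
        have h2 := hmain s (hIm hs)
        have h3 : σ ≤ Real.sqrt (F (V s)) :=
          Real.sqrt_le_sqrt (hFm (haV m hmI).le (haV s hsI).le (hVm hmI hsI hs.1))
        have h4 : 30 * ε / Real.sqrt (F (V s)) * (p s - q s) ≤ 30 * ε / σ * (p s - q s) := by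
          have : 0 ≤ p s - q s := by linarith [hpq s hsI]
          gcongr
        rw [one_div_mul_eq_div, one_div_mul_eq_div]
        linarith)
    · have h2 : 30 * ε / σ * (V b - W b) ≤ 30 * ε / σ * M := by
        have := hM b (hsubI hb)
        gcongr
      have h3 : 0 ≤ 30 * ε / σ * (V m - W m) := by
        have : 0 ≤ V m - W m := by linarith [hWV m hmI]
        positivity
      linarith
    · refine ContinuousOn.add (ContinuousOn.sub ?_ ?_)
        (((hV.cont.sub hWc).mono hI).const_smul (30 * ε / σ))
      · exact fun s hs => (hΨd _ (haV s (hI hs))).continuousAt.comp_continuousWithinAt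
          ((hV.cont.mono hI) s hs)
      · exact fun s hs => (hΨd _ (haW s (hI hs))).continuousAt.comp_continuousWithinAt
          ((hWc.mono hI) s hs)
  have hup : Ψ (V m) - Ψ (W m) ≤ 30 * ε / σ * M := by
    have h1 : Tendsto (fun b => Ψ (V b) - Ψ (W b) + 30 * ε / σ * M) (𝓝[<] 0)
        (𝓝 (c - c + 30 * ε / σ * M)) :=
      ((hlim.comp hVtop).sub (hlim.comp hWtop)).add tendsto_const_nhds
    rw [sub_self, zero_add] at h1
    refine ge_of_tendsto h1 ?_
    filter_upwards [Ico_mem_nhdsLT hm.2] with b hb using hle b hb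
  have hg := hgap m (hsub₂ (hsub hmm))
  have hlow := div_sqrt_le_integral_inv_sqrt hf hF ha hfpos hY (haW m hmI)
    (by linarith : W m < V m)
  have h1 : (V m - W m) / σ ≤ 30 * ε / σ * M := hlow.trans hup
  rw [div_mul_eq_mul_div, div_le_div_iff_of_pos_right hσ0] at h1
  linarith

end comparison

section comparison

variable {V p W q ρ f F : ℝ → ℝ} {a δ K L : ℝ}

theorem exists_integral_sub_le (hδ : 0 < δ)
    (hV : SubPrim V p (fun t => ρ t * f (V t)) (Ioo (-δ) 0))
    (hW : SubPrim (fun t => -W t) (fun t => -q t) (fun t => -(ρ t * f (W t))) (Ioo (-δ) 0))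
    (hρc : ContinuousOn ρ (Ioo (-δ) 0)) (hρ0 : ∀ t ∈ Ioo (-δ) 0, 0 ≤ ρ t)
    (hρ1 : ∀ t ∈ Ioo (-δ) 0, ρ t ≤ 1) (hρt : Tendsto ρ (𝓝[<] 0) (𝓝 1)) (hL : 0 ≤ L)
    (hρL : ∀ x ∈ Ioo (-δ) 0, ∀ y ∈ Ioo (-δ) 0, x ≤ y → ρ y ≤ ρ x * (1 + L * (y - x)))
    (hf : Continuous f) (hF : ∀ t, F t = ∫ s in a..t, f s) (ha : 0 < f a)
    (hfpos : ∀ t, a < t → 0 ≤ f t)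
    (hKO : ∃ M, a < M ∧ IntegrableOn (fun t => 1 / Real.sqrt (F t)) (Ici M))
    (hK : 0 ≤ K) (hfK : ∀ x y, x ≤ y → f x - f y ≤ K * (y - x))
    (hWm : MonotoneOn W (Ioo (-δ) 0)) (haW : ∀ t ∈ Ioo (-δ) 0, a < W t)
    (hWV : ∀ t ∈ Ioo (-δ) 0, W t ≤ V t) (hWtop : Tendsto W (𝓝[<] 0) atTop) :
    ∃ t₀ ∈ Ioo (-δ) 0, ∃ M C, ∀ t ∈ Ico t₀ 0,
      V t - W t ≤ M ∧ ∫ s in t₀..t, ρ s * (f (V s) - f (W s)) ≤ C := by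
  have hWc : ContinuousOn W (Ioo (-δ) 0) := by simpa using hW.cont.fun_neg
  obtain ⟨t₀, ht₀, hKt, hLt⟩ : ∃ t₀ ∈ Ioo (-δ) 0, K * t₀ ^ 2 ≤ 1 / 4 ∧ 2 * L * (-t₀) ≤ 1 := by
    set r := min (δ / 2) (1 / (2 * (K + L + 1))) with hr
    have hr0 : 0 < r := lt_min (by linarith) (by positivity)
    have hrδ : r ≤ δ / 2 := min_le_left _ _
    have hrK : r ≤ 1 / (2 * (K + L + 1)) := min_le_right _ _
    rw [le_div_iff₀ (by positivity)] at hrK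
    refine ⟨-r, ⟨by linarith, by linarith⟩, ?_, by nlinarith⟩
    have h1 : K * r ≤ 1 / 2 := by nlinarith
    have h2 : r ≤ 1 / 2 := by nlinarith [mul_nonneg hK hr0.le, mul_nonneg hL hr0.le]
    nlinarith [mul_nonneg hK hr0.le]
  have hI : Ico t₀ 0 ⊆ Ioo (-δ) 0 := fun t ht => ⟨ht₀.1.trans_le ht.1, ht.2⟩
  set M := 2 * max (V t₀ - W t₀) 0 with hMdef
  have hM0 : 0 ≤ M := by positivity
  have hM : ∀ t ∈ Ico t₀ 0, V t - W t ≤ M := fun t ht =>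
    sub_le_two_mul_max hV hW hρc hρ0 hρ1 hL hρL hf hK hfK hWm
      (fun t ht => hfpos _ (haW t ht)) hWtop ht₀ hKt hLt ht
  have hβ : ContinuousOn (fun t => ρ t * f (W t)) (Ioo (-δ) 0) :=
    hρc.mul (hf.comp_continuousOn hWc)
  have hα : ContinuousOn (fun t => ρ t * f (V t)) (Ioo (-δ) 0) :=
    hρc.mul (hf.comp_continuousOn hV.cont)
  have hπ : ∀ x ∈ Ico t₀ 0, ∀ y ∈ Ico t₀ 0, x ≤ y →
      ∫ s in x..y, ρ s * (f (V s) - f (W s)) ≤ (p y - q y) - (p x - q x) := by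
    intro x hx y hy hxy
    have h1 := hV.incr x (hI hx) y (hI hy) hxy
    have h2 := hW.incr x (hI hx) y (hI hy) hxy
    have hxyI : uIcc x y ⊆ Ioo (-δ) 0 := ordConnected_Ioo.uIcc_subset (hI hx) (hI hy)
    rw [intervalIntegral.integral_neg] at h2
    simp only [mul_sub]
    rw [intervalIntegral.integral_sub (hα.mono hxyI).intervalIntegrable
      (hβ.mono hxyI).intervalIntegrable]
    linarith
  have hπ' : ∀ x ∈ Ico t₀ 0, ∀ y ∈ Ico t₀ 0, x ≤ y →
      -(K * M) * (y - x) ≤ (p y - q y) - (p x - q x) := by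
    intro x hx y hy hxy
    refine le_trans ?_ (hπ x hx y hy hxy)
    have hxyI : uIcc x y ⊆ Ioo (-δ) 0 := ordConnected_Ioo.uIcc_subset (hI hx) (hI hy)
    have : ∫ s in x..y, -(K * M) ≤ ∫ s in x..y, ρ s * (f (V s) - f (W s)) := by
      apply intervalIntegral.integral_mono_on hxy (by simp)
      · simp only [mul_sub]
        exact ((hα.sub hβ).mono hxyI).intervalIntegrable
      · intro s hs
        have hs' : s ∈ Ico t₀ 0 := ⟨hx.1.trans hs.1, hs.2.trans_lt hy.2⟩
        have h1 := hfK _ _ (hWV s (hI hs'))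
        have h2 : K * (V s - W s) ≤ K * M := mul_le_mul_of_nonneg_left (hM s hs') hK
        have h3 := hρ0 s (hI hs')
        have h4 := hρ1 s (hI hs')
        have h5 : 0 ≤ K * M := by positivity
        have h6 := mul_le_mul_of_nonneg_left (h1.trans h2) h3
        nlinarith [mul_le_mul_of_nonneg_right h4 h5]
    rw [intervalIntegral.integral_const, smul_eq_mul] at this
    linarith
  refine ⟨t₀, ht₀, M, ?_⟩
  by_cases hB : ∃ B, ∀ t ∈ Ico t₀ 0, p t - q t ≤ B
  · obtain ⟨B, hB⟩ := hB
    refine ⟨B - (p t₀ - q t₀), fun t ht => ⟨hM t ht, ?_⟩⟩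
    linarith [hπ t₀ ⟨le_rfl, ht₀.2⟩ t ht ht.1, hB t ht]
  · push Not at hB
    obtain ⟨s, hs, hsB⟩ := hB (1 + K * M * (-t₀))
    have hsub : Ioo s 0 ⊆ Ioo (-δ) 0 := fun t ht => ⟨(hI hs).1.trans ht.1, ht.2⟩
    have hsub' : ∀ {t}, t ∈ Ioo s 0 → t ∈ Ico t₀ 0 := fun ht => ⟨hs.1.trans ht.1.le, ht.2⟩
    refine (false_of_one_le_sub hs.2 (hV.mono hsub) (hW.mono hsub) (hρc.mono hsub)
      (fun t ht => hρ0 t (hsub ht)) (fun t ht => hρ1 t (hsub ht)) hρt hf hF ha hfpos hKO hK hfK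
      (hWm.mono hsub) (fun t ht => haW t (hsub ht)) (fun t ht => hWV t (hsub ht)) hWtop
      (fun t ht => hM t (hsub' ht)) (fun t ht => ?_)).elim
    have h1 := hπ' s hs t (hsub' ht) ht.1.le
    have h2 : K * M * (t - s) ≤ K * M * (-t₀) :=
      mul_le_mul_of_nonneg_left (by linarith [ht.2, hs.1]) (by positivity)
    linarith

end comparison

theorem IsLocalMax.second_deriv_nonpos {ψ ψ' : ℝ → ℝ} {c x : ℝ} (h : IsLocalMax ψ x)
    (hd : ∀ᶠ y in 𝓝 x, HasDerivAt ψ (ψ' y) y) (hd' : HasDerivAt ψ' c x) : c ≤ 0 := by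
  by_contra! hc
  have hev : deriv ψ =ᶠ[𝓝 x] ψ' := hd.mono fun y hy => hy.deriv
  have h2 : deriv (deriv ψ) x = c := by rw [hev.deriv_eq, hd'.deriv]
  have hmin : IsLocalMin ψ x := isLocalMin_of_deriv_deriv_pos (by rwa [h2]) h.deriv_eq_zero
    hd.self_of_nhds.continuousAt
  have hconst : ψ =ᶠ[𝓝 x] fun _ => ψ x := by
    filter_upwards [h, hmin] with y h3 h4 using le_antisymm h3 h4
  have h5 : deriv (deriv ψ) x = 0 := by
    have : deriv ψ =ᶠ[𝓝 x] fun _ => 0 := by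
      filter_upwards [hconst.deriv] with y hy
      rw [hy, deriv_const]
    rw [this.deriv_eq, deriv_const]
  linarith

theorem IsLocalMin.second_deriv_nonneg {ψ ψ' : ℝ → ℝ} {c x : ℝ} (h : IsLocalMin ψ x)
    (hd : ∀ᶠ y in 𝓝 x, HasDerivAt ψ (ψ' y) y) (hd' : HasDerivAt ψ' c x) : 0 ≤ c := by
  have := h.neg.second_deriv_nonpos (ψ' := fun y => -ψ' y) (hd.mono fun y hy => hy.fun_neg)
    hd'.fun_neg
  linarith

/-- The one-dimensional viscosity inequality satisfied by a radial majorant of `v` touching `v`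
at `x₀`, in the time variable `T r = ∫ r^{-n} dr` for which radial harmonic functions are affine. -/
theorem pow_mul_lapl_le {n : ℕ} {T G h h' : ℝ → ℝ} {c : ℝ}
    {v : EuclideanSpace ℝ (Fin (n + 1)) → ℝ} {x₀ : EuclideanSpace ℝ (Fin (n + 1))}
    (hT : ∀ r, 0 < r → HasDerivAt T ((r ^ n)⁻¹) r) (hx₀ : x₀ ≠ 0) (hv : ContDiffAt ℝ 2 v x₀)
    (hG₀ : v x₀ = G (T ‖x₀‖)) (hG : ∀ᶠ x in 𝓝 x₀, v x ≤ G (T ‖x‖))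
    (hh : ∀ᶠ y in 𝓝 (T ‖x₀‖), HasDerivAt h (h' y) y) (hh' : HasDerivAt h' c (T ‖x₀‖))
    (hmax : IsLocalMax (fun y => G y - h y) (T ‖x₀‖)) :
    ‖x₀‖ ^ (2 * n) * lapl v x₀ ≤ c := by
  have hr : 0 < ‖x₀‖ := norm_pos_iff.mpr hx₀
  have hTc : Tendsto (fun x => T ‖x‖) (𝓝 x₀) (𝓝 (T ‖x₀‖)) :=
    (hT _ hr).continuousAt.tendsto.comp continuous_norm.continuousAt
  have hmax' : IsLocalMax (fun x => v x - h (T ‖x‖)) x₀ := by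
    filter_upwards [hG, hTc.eventually hmax] with x h1 h2
    rw [hG₀]
    linarith
  set r := ‖x₀‖ with hrdef
  have hi : ∀ i, iteratedFDeriv ℝ 2 v x₀ ![EuclideanSpace.single i 1, EuclideanSpace.single i 1] ≤
      c * (x₀ i / r ^ (n + 1)) ^ 2 +
        h' (T r) * (1 / r ^ (n + 1) - (n + 1) * x₀ i ^ 2 / r ^ (n + 3)) := by
    intro i
    set e : EuclideanSpace ℝ (Fin (n + 1)) := EuclideanSpace.single i 1 with he
    set γ : ℝ → EuclideanSpace ℝ (Fin (n + 1)) := fun s => x₀ + s • e with hγ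
    have hγ0 : γ 0 = x₀ := by simp [hγ]
    have hγd : ∀ s, HasDerivAt γ e s := fun s => by
      have := ((hasDerivAt_id s).smul_const e).const_add x₀
      rwa [one_smul] at this
    have hγc : Tendsto γ (𝓝 0) (𝓝 x₀) := by
      have := (hγd 0).continuousAt.tendsto
      rwa [hγ0] at this
    have hloc : IsLocalMax (fun s => v (γ s) - h (T ‖γ s‖)) 0 := by
      filter_upwards [hγc.eventually hmax'] with s hs
      rw [hγ0]
      exact hs
    set y : ℝ → ℝ := fun s => ‖γ s‖ with hy
    have hy0 : y 0 = r := by rw [hy]; simp only [hγ0]; rfl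
    have hyd : ∀ s, γ s ≠ 0 → HasDerivAt y ((x₀ i + s) / y s) s := by
      intro s hs
      have hsq : ∀ s, ‖γ s‖ ^ 2 = r ^ 2 + 2 * (s * x₀ i) + s ^ 2 := by
        intro s
        rw [hγ, norm_add_sq_real, real_inner_smul_right, norm_smul, he,
          EuclideanSpace.inner_single_right]
        simp [hrdef]
      have h1 : HasDerivAt (fun s => r ^ 2 + 2 * (s * x₀ i) + s ^ 2) (2 * (x₀ i + s)) s := by
        have := ((((hasDerivAt_id s).mul_const (x₀ i)).const_mul 2).const_add (r ^ 2)).fun_add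
          ((hasDerivAt_id s).fun_pow 2)
        refine this.congr_deriv ?_
        simp; ring
      have h2 := h1.sqrt (by rw [← hsq]; positivity)
      have h3 : (fun s => Real.sqrt (r ^ 2 + 2 * (s * x₀ i) + s ^ 2)) = y := by
        funext s
        rw [← hsq, Real.sqrt_sq (norm_nonneg _)]
      have h4 := congrFun h3 s
      simp only at h4
      rw [h3, h4] at h2
      refine h2.congr_deriv ?_
      rw [mul_div_mul_left _ _ two_ne_zero]
    have hne : ∀ᶠ s in 𝓝 0, γ s ≠ 0 := hγc.eventually (isOpen_ne.mem_nhds hx₀)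
    have hθd : ∀ s, γ s ≠ 0 → HasDerivAt (fun s => T (y s)) ((x₀ i + s) / y s ^ (n + 1)) s := by
      intro s hs
      have hys : 0 < y s := norm_pos_iff.mpr hs
      refine ((hT (y s) hys).comp s (hyd s hs)).congr_deriv ?_
      field_simp
      ring
    have hγx : γ 0 ≠ 0 := by rwa [hγ0]
    have hθd' : HasDerivAt (fun s => (x₀ i + s) / y s ^ (n + 1))
        (1 / r ^ (n + 1) - (n + 1) * x₀ i ^ 2 / r ^ (n + 3)) 0 := by
      have h1 := ((hasDerivAt_id (0:ℝ)).const_add (x₀ i)).fun_div ((hyd 0 hγx).fun_pow (n + 1))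
        (by rw [hy0]; positivity)
      refine h1.congr_deriv ?_
      rw [hy0]
      simp
      field_simp
      ring
    have hθc : Tendsto (fun s => T (y s)) (𝓝 0) (𝓝 (T r)) := by
      have := (hθd 0 hγx).continuousAt.tendsto
      rwa [hy0] at this
    have hhd : ∀ᶠ s in 𝓝 0, HasDerivAt (fun s => h (T (y s)))
        (h' (T (y s)) * ((x₀ i + s) / y s ^ (n + 1))) s := by
      filter_upwards [hne, hθc.eventually hh] with s h1 h2
      exact h2.comp s (hθd s h1)
    have hhd' : HasDerivAt (fun s => h' (T (y s)) * ((x₀ i + s) / y s ^ (n + 1)))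
        (c * (x₀ i / r ^ (n + 1)) ^ 2 +
        h' (T r) * (1 / r ^ (n + 1) - (n + 1) * x₀ i ^ 2 / r ^ (n + 3))) 0 := by
      have h1 : HasDerivAt (fun s => h' (T (y s))) (c * ((x₀ i + 0) / y 0 ^ (n + 1))) 0 :=
        HasDerivAt.comp (h₂ := h') 0 (by rwa [hy0]) (hθd 0 hγx)
      refine (h1.fun_mul hθd').congr_deriv ?_
      rw [hy0]
      ring
    have hvd : ∀ᶠ s in 𝓝 0, HasDerivAt (fun s => v (γ s)) (fderiv ℝ v (γ s) e) s := by
      filter_upwards [hγc.eventually (hv.eventually (by simp))] with s hs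
      exact (hs.differentiableAt (by simp)).hasFDerivAt.comp_hasDerivAt s (hγd s)
    have hvd' : HasDerivAt (fun s => fderiv ℝ v (γ s) e) (iteratedFDeriv ℝ 2 v x₀ ![e, e]) 0 := by
      have h1 : DifferentiableAt ℝ (fderiv ℝ v) (γ 0) := by
        rw [hγ0]
        exact (hv.fderiv_right (m := 1) (by norm_num)).differentiableAt (by simp)
      have h2 := (h1.hasFDerivAt.comp_hasDerivAt (0:ℝ) (hγd 0)).clm_apply (hasDerivAt_const _ e)
      refine h2.congr_deriv ?_
      rw [iteratedFDeriv_two_apply, hγ0]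
      simp
    have := hloc.second_deriv_nonpos
      (by filter_upwards [hvd, hhd] with s h1 h2 using h1.fun_sub h2) (hvd'.fun_sub hhd')
    linarith
  have hsum : lapl v x₀ ≤ c / r ^ (2 * n) := by
    refine (Finset.sum_le_sum fun i _ => hi i).trans (le_of_eq ?_)
    have h1 : ∑ i, x₀ i ^ 2 = r ^ 2 := (EuclideanSpace.real_norm_sq_eq x₀).symm
    have h2 : ∀ i, c * (x₀ i / r ^ (n + 1)) ^ 2 +
        h' (T r) * (1 / r ^ (n + 1) - (n + 1) * x₀ i ^ 2 / r ^ (n + 3)) =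
        (c / r ^ (2 * n + 2) - h' (T r) * (n + 1) / r ^ (n + 3)) * x₀ i ^ 2 +
          h' (T r) / r ^ (n + 1) := by
      intro i
      field_simp
      ring
    simp only [h2]
    rw [Finset.sum_add_distrib, ← Finset.mul_sum, h1]
    simp
    field_simp
    ring
  rw [le_div_iff₀ (by positivity)] at hsum
  linarith

/-- `T` is a primitive of `r ^ (-n)` vanishing at `1`, and `R` is its inverse on `(-δ, 0)`. -/
structure RadialTime (n : ℕ) (T R : ℝ → ℝ) (δ : ℝ) : Prop where
  pos : 0 < δ
  deriv : ∀ r, 0 < r → HasDerivAt T ((r ^ n)⁻¹) r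
  map_one : T 1 = 0
  mem : ∀ t ∈ Ioo (-δ) 0, R t ∈ Ioo (1 / 2) 1
  right_inv : ∀ t ∈ Ioo (-δ) 0, T (R t) = t
  deriv_inv : ∀ t ∈ Ioo (-δ) 0, HasDerivAt R (R t ^ n) t

theorem exists_radialTime (n : ℕ) : ∃ T R δ, RadialTime n T R δ := by
  set T : ℝ → ℝ := fun r => ∫ y in (1:ℝ)..r, (y ^ n)⁻¹ with hT
  have hTd : ∀ r, 0 < r → HasDerivAt T ((r ^ n)⁻¹) r := by
    intro r hr
    refine hasDerivAt_primitive (α := fun y => (y ^ n)⁻¹) (l := 0) (r := max 1 r + 1) ?_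
      ⟨one_pos, by linarith [le_max_left 1 r]⟩ ⟨hr, by linarith [le_max_right 1 r]⟩
    exact (continuousOn_id.pow n).inv₀ fun y hy => (pow_pos hy.1 n).ne'
  have hT1 : T 1 = 0 := by simp [hT]
  have hTc : ContinuousOn T (Ioi 0) := fun r hr => (hTd r hr).continuousAt.continuousWithinAt
  have hTm : StrictMonoOn T (Ioi 0) := by
    refine strictMonoOn_of_deriv_pos (convex_Ioi 0) hTc fun r hr => ?_
    rw [interior_Ioi] at hr
    rw [(hTd r hr).deriv]
    have : 0 < r := hr
    positivity
  have hhalf : (1 / 2 : ℝ) ∈ Ioi (0:ℝ) := by norm_num [mem_Ioi]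
  have hone : (1 : ℝ) ∈ Ioi (0:ℝ) := by norm_num [mem_Ioi]
  have hδ : T (1 / 2) < 0 := hT1 ▸ hTm hhalf hone (by norm_num)
  have hsub : Icc (1 / 2 : ℝ) 1 ⊆ Ioi 0 := fun x hx => lt_of_lt_of_le (by norm_num) hx.1
  have hex : ∀ t, ∃ r, t ∈ Ioo (T (1 / 2)) 0 → r ∈ Ioo (1 / 2) 1 ∧ T r = t := by
    intro t
    by_cases ht : t ∈ Ioo (T (1 / 2)) 0
    · obtain ⟨r, hr, hrt⟩ := intermediate_value_Ioo (by norm_num : (1 / 2 : ℝ) ≤ 1)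
        (hTc.mono hsub) (by rwa [hT1])
      exact ⟨r, fun _ => ⟨hr, hrt⟩⟩
    · exact ⟨0, fun h => (ht h).elim⟩
  choose R hR using hex
  refine ⟨T, R, -T (1 / 2), by linarith, hTd, hT1, ?_, ?_, ?_⟩ <;> rw [neg_neg]
  · exact fun t ht => (hR t ht).1
  · exact fun t ht => (hR t ht).2
  intro t ht
  have hRpos : ∀ t ∈ Ioo (T (1 / 2)) 0, R t ∈ Ioi (0:ℝ) := fun t ht =>
    hsub (Ioo_subset_Icc_self (hR t ht).1)
  have hRm : StrictMonoOn R (Ioo (T (1 / 2)) 0) := by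
    intro x hx y hy hxy
    rw [← hTm.lt_iff_lt (hRpos x hx) (hRpos y hy), (hR x hx).2, (hR y hy).2]
    exact hxy
  have himg : Ioo (1 / 2) 1 ⊆ R '' Ioo (T (1 / 2)) 0 := by
    intro r hr
    have hr0 := hsub (Ioo_subset_Icc_self hr)
    have hTr : T r ∈ Ioo (T (1 / 2)) 0 := ⟨hTm hhalf hr0 hr.1, hT1 ▸ hTm hr0 hone hr.2⟩
    exact ⟨T r, hTr, hTm.injOn (hRpos _ hTr) hr0 (hR _ hTr).2⟩
  have hc : ContinuousAt R t := hRm.continuousAt_of_image_mem_nhds (isOpen_Ioo.mem_nhds ht)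
    (mem_of_superset (isOpen_Ioo.mem_nhds (hR t ht).1) himg)
  have h0 : 0 < R t := hRpos t ht
  have := HasDerivAt.of_local_left_inverse hc (hTd (R t) h0) (by positivity)
    (by filter_upwards [isOpen_Ioo.mem_nhds ht] with s hs using (hR s hs).2)
  rwa [inv_inv] at this

namespace RadialTime

variable {n : ℕ} {T R : ℝ → ℝ} {δ : ℝ}

theorem strictMonoOn (h : RadialTime n T R δ) : StrictMonoOn T (Ioi 0) := by
  refine strictMonoOn_of_deriv_pos (convex_Ioi 0)
    (fun r hr => (h.deriv r hr).continuousAt.continuousWithinAt) fun r hr => ?_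
  rw [interior_Ioi] at hr
  rw [(h.deriv r hr).deriv]
  have : 0 < r := hr
  positivity

theorem mono (h : RadialTime n T R δ) {δ' : ℝ} (hδ' : 0 < δ') (hle : δ' ≤ δ) :
    RadialTime n T R δ' := by
  have hsub : Ioo (-δ') 0 ⊆ Ioo (-δ) 0 := Ioo_subset_Ioo_left (by linarith)
  exact ⟨hδ', h.deriv, h.map_one, fun t ht => h.mem t (hsub ht),
    fun t ht => h.right_inv t (hsub ht), fun t ht => h.deriv_inv t (hsub ht)⟩

theorem inv_pos (h : RadialTime n T R δ) {t : ℝ} (ht : t ∈ Ioo (-δ) 0) : 0 < R t :=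
  lt_trans (by norm_num) (h.mem t ht).1

theorem left_inv (h : RadialTime n T R δ) {r : ℝ} (hr : 0 < r) (ht : T r ∈ Ioo (-δ) 0) :
    R (T r) = r :=
  h.strictMonoOn.injOn (h.inv_pos ht) hr (h.right_inv _ ht)

theorem continuousOn_inv (h : RadialTime n T R δ) : ContinuousOn R (Ioo (-δ) 0) := fun t ht =>
  (h.deriv_inv t ht).continuousAt.continuousWithinAt

theorem tendsto_inv (h : RadialTime n T R δ) : Tendsto R (𝓝[<] 0) (𝓝[<] 1) := by
  have hIoo : Ioo (-δ) 0 ∈ 𝓝[<] (0:ℝ) := Ioo_mem_nhdsLT (by linarith [h.pos])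
  apply tendsto_nhdsWithin_of_tendsto_nhds_of_eventually_within
  · refine tendsto_order.mpr ⟨fun c hc => ?_, fun c hc => ?_⟩
    · set b := max c (1 / 2) with hb
      have hb0 : 0 < b := lt_of_lt_of_le (by norm_num) (le_max_right c (1 / 2))
      have hb1 : T b < 0 := h.map_one ▸ h.strictMonoOn hb0 (mem_Ioi.mpr one_pos)
        (max_lt hc (by norm_num))
      filter_upwards [hIoo, Ioo_mem_nhdsLT hb1] with t ht ht'
      refine (le_max_left c (1 / 2)).trans_lt ?_
      rw [← hb, ← h.strictMonoOn.lt_iff_lt hb0 (h.inv_pos ht), h.right_inv t ht]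
      exact ht'.1
    · filter_upwards [hIoo] with t ht using (h.mem t ht).2.trans hc
  · filter_upwards [hIoo] with t ht using (h.mem t ht).2

theorem mem_of_le (h : RadialTime n T R δ) {t r : ℝ} (ht : t ∈ Ioo (-δ) 0) (hr : R t ≤ r)
    (hr1 : r < 1) : T r ∈ Ico t 0 := by
  have hr0 : 0 < r := (h.inv_pos ht).trans_le hr
  refine ⟨?_, h.map_one ▸ h.strictMonoOn hr0 (mem_Ioi.mpr one_pos) hr1⟩
  rw [← h.right_inv t ht]
  exact h.strictMonoOn.monotoneOn (h.inv_pos ht) hr0 hr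

theorem weight_le (h : RadialTime n T R δ) {x y : ℝ} (hx : x ∈ Ioo (-δ) 0) (hy : y ∈ Ioo (-δ) 0)
    (hxy : x ≤ y) :
    R y ^ (2 * n) ≤ R x ^ (2 * n) * (1 + 2 * n * 4 ^ n * (y - x)) := by
  have h1 := le_of_right_deriv_nonneg
    (G := fun t => 2 * n * t - R t ^ (2 * n))
    (g := fun t => 2 * n - (2 * n) * R t ^ (2 * n - 1) * R t ^ n) hxy
    (by
      refine ((by fun_prop : Continuous fun t : ℝ => 2 * n * t).continuousOn).sub ?_
      exact (h.continuousOn_inv.pow (2 * n)).mono (ordConnected_Ioo.out hx hy))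
    (fun s hs => by
      have hs' := ordConnected_Ioo.out hx hy ⟨hs.1, hs.2.le⟩
      have h2 := ((hasDerivAt_id s).const_mul (2 * n : ℝ)).fun_sub
        ((h.deriv_inv s hs').fun_pow (2 * n))
      refine (h2.congr_deriv ?_).hasDerivWithinAt
      push_cast
      ring)
    (fun s hs => by
      have hs' := ordConnected_Ioo.out hx hy ⟨hs.1, hs.2.le⟩
      have h3 := h.inv_pos hs'
      have h4 := (h.mem s hs').2.le
      have h5 : R s ^ (2 * n - 1) * R s ^ n ≤ 1 :=
        mul_le_one₀ (pow_le_one₀ h3.le h4) (by positivity) (pow_le_one₀ h3.le h4)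
      have h6 : (0:ℝ) ≤ 2 * n := by positivity
      have := mul_le_mul_of_nonneg_left h5 h6
      linarith)
  have h7 : 1 ≤ R x ^ (2 * n) * 4 ^ n := by
    rw [pow_mul, ← mul_pow]
    apply one_le_pow₀
    have := (h.mem x hx).1
    nlinarith
  have h8 : 0 ≤ 2 * n * (y - x) := by
    have : 0 ≤ y - x := by linarith
    positivity
  nlinarith [mul_le_mul_of_nonneg_left h7 h8]

end RadialTime

section sphere

variable {n : ℕ}

/-- The maximum of `U` over the sphere of radius `r`. -/
noncomputable def sphereMax (U : EuclideanSpace ℝ (Fin (n + 1)) → ℝ) (r : ℝ) : ℝ :=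
  sSup ((fun θ : sphere (0 : EuclideanSpace ℝ (Fin (n + 1))) 1 => U (r • (θ : _))) '' univ)

variable {U : EuclideanSpace ℝ (Fin (n + 1)) → ℝ}

theorem smul_sphere_mem_ball {r : ℝ} (hr : r ∈ Ioo 0 1)
    (θ : sphere (0 : EuclideanSpace ℝ (Fin (n + 1))) 1) :
    r • (θ : EuclideanSpace ℝ (Fin (n + 1))) ∈ ball 0 1 := by
  rw [mem_ball_zero_iff, norm_smul, norm_eq_of_mem_sphere θ, mul_one, Real.norm_of_nonneg hr.1.le]
  exact hr.2

theorem continuousOn_sphereMax (hU : ContinuousOn U (ball 0 1)) :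
    ContinuousOn (sphereMax U) (Ioo 0 1) := by
  rw [continuousOn_iff_continuous_domRestrict]
  refine IsCompact.continuous_sSup
    (f := fun (r : Ioo (0:ℝ) 1) (θ : sphere (0 : EuclideanSpace ℝ (Fin (n + 1))) 1) =>
      U ((r : ℝ) • (θ : _))) isCompact_univ ?_
  exact hU.comp_continuous (by fun_prop) fun x => smul_sphere_mem_ball x.1.2 x.2

theorem continuous_smul_sphere (hU : ContinuousOn U (ball 0 1)) {r : ℝ} (hr : r ∈ Ioo 0 1) :
    Continuous fun θ : sphere (0 : EuclideanSpace ℝ (Fin (n + 1))) 1 =>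
      U (r • (θ : EuclideanSpace ℝ (Fin (n + 1)))) :=
  hU.comp_continuous (by fun_prop) (smul_sphere_mem_ball hr)

theorem le_sphereMax (hU : ContinuousOn U (ball 0 1)) {x : EuclideanSpace ℝ (Fin (n + 1))}
    (hx : ‖x‖ ∈ Ioo 0 1) : U x ≤ sphereMax U ‖x‖ := by
  refine le_csSup (isCompact_univ.image (continuous_smul_sphere hU hx)).bddAbove
    ⟨⟨‖x‖⁻¹ • x, ?_⟩, mem_univ _, ?_⟩
  · rw [mem_sphere_zero_iff_norm, norm_smul, norm_inv, norm_norm, inv_mul_cancel₀ hx.1.ne']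
  · simp only
    rw [smul_smul, mul_inv_cancel₀ hx.1.ne', one_smul]

theorem exists_eq_sphereMax (hU : ContinuousOn U (ball 0 1)) {r : ℝ} (hr : r ∈ Ioo 0 1) :
    ∃ x, ‖x‖ = r ∧ U x = sphereMax U r := by
  have hne : Nonempty (sphere (0 : EuclideanSpace ℝ (Fin (n + 1))) 1) :=
    (NormedSpace.sphere_nonempty.mpr zero_le_one).to_subtype
  obtain ⟨θ, -, hθ⟩ := (isCompact_univ.image (continuous_smul_sphere hU hr)).sSup_mem
    (univ_nonempty.image _)
  refine ⟨r • (θ : _), ?_, hθ⟩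
  rw [norm_smul, norm_eq_of_mem_sphere θ, mul_one, Real.norm_of_nonneg hr.1.le]

theorem viscositySub_sphereMax {T R g : ℝ → ℝ} {δ t : ℝ} (h : RadialTime n T R δ)
    {v₁ v₂ : EuclideanSpace ℝ (Fin (n + 1)) → ℝ}
    (hv₁ : ContDiffOn ℝ 2 v₁ (ball 0 1)) (hv₂ : ContDiffOn ℝ 2 v₂ (ball 0 1))
    (hl₁ : ∀ x ∈ ball 0 1, lapl v₁ x = g (v₁ x)) (hl₂ : ∀ x ∈ ball 0 1, lapl v₂ x = g (v₂ x))
    (ht : t ∈ Ioo (-δ) 0) :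
    ViscositySub (fun t => sphereMax (fun x => max (v₁ x) (v₂ x)) (R t))
      (fun t => R t ^ (2 * n) * g (sphereMax (fun x => max (v₁ x) (v₂ x)) (R t))) t := by
  have hU : ContinuousOn (fun x => max (v₁ x) (v₂ x)) (ball 0 1) :=
    ContinuousOn.sup hv₁.continuousOn hv₂.continuousOn
  have hRt : R t ∈ Ioo 0 1 := ⟨h.inv_pos ht, (h.mem t ht).2⟩
  obtain ⟨x₀, hx₀, hx₀U⟩ := exists_eq_sphereMax hU hRt
  have hx₀b : x₀ ∈ ball 0 1 := by rw [mem_ball_zero_iff, hx₀]; exact hRt.2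
  have hx₀0 : x₀ ≠ 0 := norm_pos_iff.mp (hx₀ ▸ hRt.1)
  have hTx : T ‖x₀‖ = t := by rw [hx₀, h.right_inv t ht]
  have key : ∀ v : EuclideanSpace ℝ (Fin (n + 1)) → ℝ, ContDiffOn ℝ 2 v (ball 0 1) →
      (∀ x ∈ ball 0 1, lapl v x = g (v x)) → (∀ x, v x ≤ max (v₁ x) (v₂ x)) →
      max (v₁ x₀) (v₂ x₀) = v x₀ →
      ViscositySub (fun t => sphereMax (fun x => max (v₁ x) (v₂ x)) (R t))
      (fun t => R t ^ (2 * n) * g (sphereMax (fun x => max (v₁ x) (v₂ x)) (R t))) t := by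
    intro v hv hl hle heq h₀ h₁ c hh hh' hmax
    have hT : ContinuousAt (fun x : EuclideanSpace ℝ (Fin (n + 1)) => T ‖x‖) x₀ :=
      ContinuousAt.comp (g := T) (h.deriv _ (norm_pos_iff.mpr hx₀0)).continuousAt
        continuous_norm.continuousAt
    have hG : ∀ᶠ x in 𝓝 x₀,
        v x ≤ (fun t => sphereMax (fun x => max (v₁ x) (v₂ x)) (R t)) (T ‖x‖) := by
      filter_upwards [hT.eventually_mem (isOpen_Ioo.mem_nhds (hTx ▸ ht)),
        isOpen_ball.mem_nhds hx₀b, isOpen_ne.mem_nhds hx₀0] with x h2 h3 h4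
      have hx0 : 0 < ‖x‖ := norm_pos_iff.mpr h4
      rw [h.left_inv hx0 h2]
      exact (hle x).trans (le_sphereMax hU ⟨hx0, mem_ball_zero_iff.mp h3⟩)
    have h5 := pow_mul_lapl_le (n := n) (x₀ := x₀)
      (G := fun t => sphereMax (fun x => max (v₁ x) (v₂ x)) (R t)) h.deriv hx₀0
      (hv.contDiffAt (isOpen_ball.mem_nhds hx₀b)) (by rw [hTx, ← hx₀U, heq]) hG
      (by rwa [hTx]) (by rwa [hTx]) (by rwa [hTx])
    rw [hl x₀ hx₀b, ← heq, hx₀] at h5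
    simp only
    rw [← hx₀U]
    exact h5
  rcases max_choice (v₁ x₀) (v₂ x₀) with h1 | h1
  · exact key v₁ hv₁ hl₁ (fun x => le_max_left _ _) h1
  · exact key v₂ hv₂ hl₂ (fun x => le_max_right _ _) h1

end sphere

section future

variable {w : ℝ → ℝ} {l : ℝ}

/-- The largest nondecreasing minorant of `w` on `(l, 0)`. -/
noncomputable def futureInf (w : ℝ → ℝ) (t : ℝ) : ℝ := sInf (w '' Ico t 0)

theorem exists_isMinOn_future (hw : ContinuousOn w (Ioo l 0)) (hwt : Tendsto w (𝓝[<] 0) atTop)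
    {t : ℝ} (ht : t ∈ Ioo l 0) : ∃ s ∈ Ico t 0, IsMinOn w (Ico t 0) s := by
  obtain ⟨m, hm, hmw⟩ := (mem_nhdsLT_iff_exists_Ico_subset).mp
    (hwt.eventually (eventually_ge_atTop (w t)))
  set b := max m t with hb
  have hb0 : b < 0 := max_lt hm ht.2
  have htb : t ≤ b := le_max_right _ _
  obtain ⟨s, hs, hmin⟩ := isCompact_Icc.exists_isMinOn ⟨t, le_rfl, htb⟩
    (hw.mono fun x hx => ⟨ht.1.trans_le hx.1, hx.2.trans_lt hb0⟩ : ContinuousOn w (Icc t b))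
  refine ⟨s, ⟨hs.1, hs.2.trans_lt hb0⟩, fun x hx => ?_⟩
  rcases le_or_gt x b with h | h
  · exact hmin ⟨hx.1, h⟩
  · have h1 : w s ≤ w t := hmin ⟨le_rfl, htb⟩
    have h2 : w t ≤ w x := hmw ⟨(le_max_left m t).trans h.le, hx.2⟩
    exact h1.trans h2

theorem exists_eq_futureInf (hw : ContinuousOn w (Ioo l 0)) (hwt : Tendsto w (𝓝[<] 0) atTop)
    {t : ℝ} (ht : t ∈ Ioo l 0) : ∃ s ∈ Ico t 0, futureInf w t = w s := by
  obtain ⟨s, hs, hmin⟩ := exists_isMinOn_future hw hwt ht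
  have : IsLeast (w '' Ico t 0) (w s) := ⟨mem_image_of_mem w hs, by
    rintro _ ⟨x, hx, rfl⟩
    exact hmin hx⟩
  exact ⟨s, hs, this.csInf_eq⟩

theorem futureInf_le (hw : ContinuousOn w (Ioo l 0)) (hwt : Tendsto w (𝓝[<] 0) atTop)
    {t s : ℝ} (ht : t ∈ Ioo l 0) (hs : s ∈ Ico t 0) : futureInf w t ≤ w s := by
  obtain ⟨s', hs', hmin⟩ := exists_isMinOn_future hw hwt ht
  refine csInf_le ⟨w s', ?_⟩ (mem_image_of_mem w hs)
  rintro _ ⟨x, hx, rfl⟩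
  exact hmin hx

theorem monotoneOn_futureInf (hw : ContinuousOn w (Ioo l 0)) (hwt : Tendsto w (𝓝[<] 0) atTop) :
    MonotoneOn (futureInf w) (Ioo l 0) := by
  intro x hx y hy hxy
  obtain ⟨s, hs, he⟩ := exists_eq_futureInf hw hwt hy
  rw [he]
  exact futureInf_le hw hwt hx ⟨hxy.trans hs.1, hs.2⟩

theorem tendsto_futureInf (hw : ContinuousOn w (Ioo l 0)) (hwt : Tendsto w (𝓝[<] 0) atTop)
    (hl : l < 0) : Tendsto (futureInf w) (𝓝[<] 0) atTop := by
  refine tendsto_atTop.mpr fun B => ?_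
  obtain ⟨m, hm, hmw⟩ := (mem_nhdsLT_iff_exists_Ico_subset).mp
    (hwt.eventually (eventually_ge_atTop B))
  filter_upwards [Ico_mem_nhdsLT hm, Ioo_mem_nhdsLT hl] with t ht htl
  obtain ⟨s, hs, he⟩ := exists_eq_futureInf hw hwt htl
  rw [he]
  exact hmw ⟨ht.1.trans hs.1, hs.2⟩

theorem continuousOn_futureInf (hw : ContinuousOn w (Ioo l 0))
    (hwt : Tendsto w (𝓝[<] 0) atTop) : ContinuousOn (futureInf w) (Ioo l 0) := by
  intro t ht
  apply ContinuousAt.continuousWithinAt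
  rw [Metric.continuousAt_iff]
  intro ε hε
  obtain ⟨η, hη, hηw⟩ := Metric.continuousAt_iff.mp (hw.continuousAt (isOpen_Ioo.mem_nhds ht))
    (ε / 3) (by positivity)
  obtain ⟨η', hη', hηI⟩ := Metric.mem_nhds_iff.mp (isOpen_Ioo.mem_nhds ht)
  have key : ∀ x ∈ ball t (min η η'), ∀ y ∈ ball t (min η η'), x ≤ y →
      futureInf w y < futureInf w x + ε := by
    intro x hx y hy hxy
    have hxI : x ∈ Ioo l 0 := hηI (ball_subset_ball (min_le_right _ _) hx)
    have hyI : y ∈ Ioo l 0 := hηI (ball_subset_ball (min_le_right _ _) hy)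
    obtain ⟨s, hs, he⟩ := exists_eq_futureInf hw hwt hxI
    rw [he]
    rcases le_or_gt y s with h | h
    · linarith [futureInf_le hw hwt hyI ⟨h, hs.2⟩]
    · have h1 := futureInf_le hw hwt hyI ⟨le_rfl, hyI.2⟩
      have hsb : s ∈ ball t η := by
        have hx' := ball_subset_ball (min_le_left η η') hx
        have hy' := ball_subset_ball (min_le_left η η') hy
        rw [Real.ball_eq_Ioo] at hx' hy' ⊢
        exact ⟨hx'.1.trans_le hs.1, h.trans hy'.2⟩
      have h2 := abs_lt.mp (hηw hsb)
      have h3 := abs_lt.mp (hηw (ball_subset_ball (min_le_left η η') hy))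
      linarith [h2.1, h3.2]
  refine ⟨min η η', lt_min hη hη', fun {x} hx => ?_⟩
  have htb : t ∈ ball t (min η η') := mem_ball_self (lt_min hη hη')
  have hxI : x ∈ Ioo l 0 := hηI (ball_subset_ball (min_le_right _ _) hx)
  rw [Real.dist_eq, abs_lt]
  rcases le_total x t with h | h
  · have h1 := key x hx t htb h
    have h2 := monotoneOn_futureInf hw hwt hxI ht h
    constructor <;> linarith
  · have h1 := key t htb x hx h
    have h2 := monotoneOn_futureInf hw hwt ht hxI h
    constructor <;> linarith

theorem viscositySub_neg_futureInf {ρ f : ℝ → ℝ} (hw : ContinuousOn w (Ioo l 0))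
    (hwt : Tendsto w (𝓝[<] 0) atTop)
    (hvisc : ∀ t ∈ Ioo l 0, ViscositySub (fun t => -w t) (fun t => -(ρ t * f (w t))) t)
    {t : ℝ} (ht : t ∈ Ioo l 0) (hpos : 0 ≤ ρ t * f (futureInf w t)) :
    ViscositySub (fun t => -futureInf w t) (fun t => -(ρ t * f (futureInf w t))) t := by
  intro h h' c hh hh' hmax
  obtain ⟨s, hs, he⟩ := exists_eq_futureInf hw hwt ht
  rcases hs.1.eq_or_lt with hts | hts
  · subst hts
    change -(ρ t * f (futureInf w t)) ≤ c
    rw [he]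
    refine hvisc t ht h h' c hh hh' ?_
    filter_upwards [hmax, isOpen_Ioo.mem_nhds ht] with y hy hyI
    rw [he] at hy
    have := futureInf_le hw hwt hyI ⟨le_rfl, hyI.2⟩
    linarith
  · have hmin : IsLocalMin h t := by
      filter_upwards [hmax, isOpen_Ioo.mem_nhds ht, Iio_mem_nhds hts] with y hy hyI hys
      have := futureInf_le hw hwt hyI ⟨le_of_lt hys, hs.2⟩
      rw [← he] at this
      linarith
    have := hmin.second_deriv_nonneg hh hh'
    linarith

end future

theorem lapl_neg {N : ℕ} (u : EuclideanSpace ℝ (Fin N) → ℝ) (x : EuclideanSpace ℝ (Fin N)) :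
    lapl (fun x => -u x) x = -lapl u x := by
  have : (fun x => -u x) = -u := rfl
  simp [lapl, this, iteratedFDeriv_neg_apply]

theorem IsLargeSolution.eventually_le {N : ℕ} {f : ℝ → ℝ} {u : EuclideanSpace ℝ (Fin N) → ℝ}
    (h : IsLargeSolution f u) (B : ℝ) :
    ∀ᶠ r in 𝓝[<] (1:ℝ), ∀ x, ‖x‖ = r → B ≤ u x := by
  have h1 : ∀ᶠ x in 𝓝ˢ (sphere (0 : EuclideanSpace ℝ (Fin N)) 1), x ∈ ball 0 1 → B ≤ u x := by
    rw [eventually_nhdsSet_iff_forall]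
    intro x₀ hx₀
    have := (h.2.2 x₀ hx₀).eventually (eventually_ge_atTop B)
    rwa [eventually_nhdsWithin_iff] at this
  obtain ⟨O, hO, hsO, hOB⟩ := mem_nhdsSet_iff_exists.mp h1
  obtain ⟨η, hη, hηO⟩ :=
    (isCompact_sphere (0 : EuclideanSpace ℝ (Fin N)) 1).exists_thickening_subset_open hO hsO
  filter_upwards [Ioo_mem_nhdsLT (show max (1 - η) 0 < 1 from max_lt (by linarith) one_pos)]
    with r hr x hx
  have hr0 : 0 < r := (le_max_right _ _).trans_lt hr.1
  have hr1 : 1 - η < r := (le_max_left _ _).trans_lt hr.1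
  refine hOB (hηO ?_) (by rw [mem_ball_zero_iff, hx]; exact hr.2)
  rw [mem_thickening_iff]
  refine ⟨r⁻¹ • x, ?_, ?_⟩
  · rw [mem_sphere_zero_iff_norm, norm_smul, hx, norm_inv, Real.norm_of_nonneg hr0.le,
      inv_mul_cancel₀ hr0.ne']
  · have h2 : x - r⁻¹ • x = (1 - r⁻¹) • x := by rw [sub_smul, one_smul]
    have h3 : 1 ≤ r⁻¹ := (one_le_inv₀ hr0).mpr hr.2.le
    rw [dist_eq_norm, h2, norm_smul, hx, Real.norm_of_nonpos (by linarith)]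
    have h4 : -(1 - r⁻¹) * r = 1 - r := by field_simp; ring
    rw [h4]
    linarith

theorem integral_zero_one_le {g : ℝ → ℝ} {b C : ℝ} (hb : b < 1) (hC : 0 ≤ C)
    (h : ∀ r ∈ Ico b 1, ∫ x in (0:ℝ)..r, g x ≤ C) : ∫ x in (0:ℝ)..1, g x ≤ C := by
  by_cases hg : IntervalIntegrable g volume 0 1
  · have hc := intervalIntegral.continuousOn_primitive_interval' hg left_mem_uIcc
    rw [uIcc_of_le zero_le_one] at hc
    have h1 := (hc 1 ⟨zero_le_one, le_rfl⟩).mono_left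
      (nhdsWithin_mono (s := Ioo 0 1) _ Ioo_subset_Icc_self)
    rw [nhdsWithin_Ioo_eq_nhdsLT one_pos] at h1
    refine le_of_tendsto h1 ?_
    filter_upwards [Ico_mem_nhdsLT hb] with r hr using h r hr
  · rwa [intervalIntegral.integral_undef hg]

theorem abs_sub_le_of_mem_Icc {f : ℝ → ℝ} {K M x y v w : ℝ} (hK : 0 ≤ K)
    (hfK : ∀ x y, x ≤ y → f x - f y ≤ K * (y - x)) (hx : x ∈ Icc w v) (hy : y ∈ Icc w v)
    (hM : v - w ≤ M) : |f x - f y| ≤ f v - f w + 2 * K * M := by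
  have key : ∀ z ∈ Icc w v, f z ≤ f v + K * M ∧ f w ≤ f z + K * M := by
    intro z hz
    have h1 := hfK z v hz.2
    have h2 := hfK w z hz.1
    have h3 : K * (v - z) ≤ K * M := mul_le_mul_of_nonneg_left (by linarith [hz.1]) hK
    have h4 : K * (z - w) ≤ K * M := mul_le_mul_of_nonneg_left (by linarith [hz.2]) hK
    constructor <;> linarith
  have h1 := key x hx
  have h2 := key y hy
  rw [abs_le]
  constructor <;> linarith [h1.1, h1.2, h2.1, h2.2]

theorem RadialTime.integral_le {n : ℕ} {T R V W f g : ℝ → ℝ} {δ t₀ t K M C : ℝ}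
    (h : RadialTime n T R δ) (ht₀ : t₀ ∈ Ioo (-δ) 0) (ht : t ∈ Ico t₀ 0)
    (hV : ContinuousOn V (Ioo (-δ) 0)) (hW : ContinuousOn W (Ioo (-δ) 0)) (hf : Continuous f)
    (hg : ContinuousOn g (Ico 0 1)) (hg0 : ∀ s ∈ Icc t₀ t, 0 ≤ g (R s))
    (hK : 0 ≤ K) (hM : 0 ≤ M)
    (hgle : ∀ s ∈ Icc t₀ t, g (R s) ≤ f (V s) - f (W s) + 2 * K * M)
    (hC : ∫ s in t₀..t, R s ^ (2 * n) * (f (V s) - f (W s)) ≤ C) :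
    ∫ r in (R t₀)..(R t), g r ≤ 2 ^ n * (C + 2 * K * M * (-t₀)) := by
  have hI : Icc t₀ t ⊆ Ioo (-δ) 0 := fun s hs => ⟨ht₀.1.trans_le hs.1, hs.2.trans_lt ht.2⟩
  have huI : uIcc t₀ t = Icc t₀ t := uIcc_of_le ht.1
  have hRc : ContinuousOn R (Icc t₀ t) := h.continuousOn_inv.mono hI
  have himg : R '' Icc t₀ t ⊆ Ico 0 1 := by
    rintro _ ⟨s, hs, rfl⟩
    exact ⟨(h.inv_pos (hI hs)).le, (h.mem s (hI hs)).2⟩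
  have hcov := intervalIntegral.integral_comp_mul_deriv' (a := t₀) (b := t) (f := R)
    (f' := fun s => R s ^ n) (g := g) (fun s hs => h.deriv_inv s (hI (huI ▸ hs)))
    (by rw [huI]; exact hRc.pow n) (by rw [huI]; exact hg.mono himg)
  rw [← hcov]
  have hc1 : ContinuousOn (fun s => R s ^ (2 * n) * (f (V s) - f (W s))) (Icc t₀ t) :=
    (hRc.pow _).mul ((hf.comp_continuousOn (hV.mono hI)).sub (hf.comp_continuousOn (hW.mono hI)))
  have hmono : ∫ s in t₀..t, (g ∘ R) s * R s ^ n ≤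
      ∫ s in t₀..t, 2 ^ n * (R s ^ (2 * n) * (f (V s) - f (W s)) + 2 * K * M) := by
    apply intervalIntegral.integral_mono_on ht.1
    · apply ContinuousOn.intervalIntegrable
      rw [huI]
      exact ((hg.mono himg).comp hRc (mapsTo_image _ _)).mul (hRc.pow n)
    · apply ContinuousOn.intervalIntegrable
      rw [huI]
      exact (hc1.add continuousOn_const).const_smul ((2:ℝ) ^ n)
    · intro s hs
      have hR := h.mem s (hI hs)
      have hR0 := h.inv_pos (hI hs)
      have h1 : 1 ≤ 2 ^ n * R s ^ n := by
        rw [← mul_pow]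
        exact one_le_pow₀ (by linarith [hR.1])
      have h2 : R s ^ n ≤ 2 ^ n * R s ^ (2 * n) := by
        have : R s ^ (2 * n) = R s ^ n * R s ^ n := by rw [two_mul, pow_add]
        rw [this, ← mul_assoc]
        exact le_mul_of_one_le_left (by positivity) h1
      have h3 : R s ^ (2 * n) ≤ 1 := pow_le_one₀ hR0.le hR.2.le
      have h4 := hg0 s hs
      have h5 := hgle s hs
      calc g (R s) * R s ^ n ≤ g (R s) * (2 ^ n * R s ^ (2 * n)) := by gcongr
        _ ≤ (f (V s) - f (W s) + 2 * K * M) * (2 ^ n * R s ^ (2 * n)) := by gcongr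
        _ = 2 ^ n * (R s ^ (2 * n) * (f (V s) - f (W s)) + R s ^ (2 * n) * (2 * K * M)) := by ring
        _ ≤ 2 ^ n * (R s ^ (2 * n) * (f (V s) - f (W s)) + 2 * K * M) := by
          have : R s ^ (2 * n) * (2 * K * M) ≤ 2 * K * M :=
            mul_le_of_le_one_left (by positivity) h3
          gcongr
  refine hmono.trans ?_
  rw [intervalIntegral.integral_const_mul, intervalIntegral.integral_add
    (by apply ContinuousOn.intervalIntegrable; rwa [huI]) (by simp),
    intervalIntegral.integral_const, smul_eq_mul]
  have h6 : (t - t₀) * (2 * K * M) ≤ 2 * K * M * (-t₀) := by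
    have : 0 ≤ 2 * K * M := by positivity
    nlinarith [ht.2]
  gcongr

theorem stmt19 {N : ℕ} (hN : 1 ≤ N)
    (f : ℝ → ℝ) (hf : Continuous f)
    (a : ℝ) (ha : 0 < f a) (hfpos : ∀ t, a < t → 0 ≤ f t)
    (F : ℝ → ℝ) (hF : ∀ t, F t = ∫ s in a..t, f s)
    (hKO : ∃ M, a < M ∧ IntegrableOn (fun t => 1 / Real.sqrt (F t)) (Ici M))
    (f' : ℝ → ℝ) (K : ℝ) (hf'mono : Monotone f') (hpert : ∀ t, f t = f' t - K * t)
    (u₁ u₂ : EuclideanSpace ℝ (Fin N) → ℝ)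
    (h₁ : IsLargeSolution f u₁) (h₂ : IsLargeSolution f u₂) :
    ∃ C > (0:ℝ), ∀ θ : EuclideanSpace ℝ (Fin N), ‖θ‖ = 1 →
      (∫ r in (0:ℝ)..1, |f (u₁ (r • θ)) - f (u₂ (r • θ))|) ≤ C := by
  obtain ⟨n, rfl⟩ := Nat.exists_eq_add_of_le' hN
  have hfK : ∀ x y, x ≤ y → f x - f y ≤ max K 0 * (y - x) := by
    intro x y hxy
    rw [hpert, hpert]
    have h1 := hf'mono hxy
    have h2 : K * (y - x) ≤ max K 0 * (y - x) :=
      mul_le_mul_of_nonneg_right (le_max_left _ _) (by linarith)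
    linarith
  have hK0 : 0 ≤ max K 0 := le_max_right _ _
  generalize max K 0 = k at hfK hK0
  have hc₁ := h₁.1.continuousOn
  have hc₂ := h₂.1.continuousOn
  set U : EuclideanSpace ℝ (Fin (n + 1)) → ℝ := fun x => max (u₁ x) (u₂ x) with hUdef
  set Z : EuclideanSpace ℝ (Fin (n + 1)) → ℝ := fun x => max (-u₁ x) (-u₂ x) with hZdef
  have hU : ContinuousOn U (ball 0 1) := ContinuousOn.sup hc₁ hc₂
  have hZ : ContinuousOn Z (ball 0 1) := ContinuousOn.sup hc₁.neg hc₂.neg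
  obtain ⟨T, R, δ₁, hR₁⟩ := exists_radialTime n
  set V : ℝ → ℝ := fun t => sphereMax U (R t) with hVdef
  set w : ℝ → ℝ := fun t => -sphereMax Z (R t) with hwdef
  have hwt : Tendsto w (𝓝[<] 0) atTop := by
    refine tendsto_atTop.mpr fun B => ?_
    filter_upwards [hR₁.tendsto_inv.eventually (h₁.eventually_le B),
      hR₁.tendsto_inv.eventually (h₂.eventually_le B),
      Ioo_mem_nhdsLT (neg_lt_zero.mpr hR₁.pos)] with t hB₁ hB₂ ht
    obtain ⟨x, hx, he⟩ := exists_eq_sphereMax hZ ⟨hR₁.inv_pos ht, (hR₁.mem t ht).2⟩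
    have : Z x ≤ -B := max_le (by linarith [hB₁ x hx]) (by linarith [hB₂ x hx])
    simp only [hwdef]
    linarith
  have hmaps : MapsTo R (Ioo (-δ₁) 0) (Ioo 0 1) := fun t ht =>
    ⟨hR₁.inv_pos ht, (hR₁.mem t ht).2⟩
  have hw₁ : ContinuousOn w (Ioo (-δ₁) 0) :=
    ((continuousOn_sphereMax hZ).comp hR₁.continuousOn_inv hmaps).neg
  have hV₁ : ContinuousOn V (Ioo (-δ₁) 0) :=
    (continuousOn_sphereMax hU).comp hR₁.continuousOn_inv hmaps
  set W : ℝ → ℝ := futureInf w with hWdef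
  have hWt : Tendsto W (𝓝[<] 0) atTop := tendsto_futureInf hw₁ hwt (neg_lt_zero.mpr hR₁.pos)
  obtain ⟨m, hm, haW⟩ := exists_Ico_of_eventually (neg_lt_zero.mpr hR₁.pos)
    (hWt.eventually (eventually_gt_atTop a))
  obtain ⟨δ, rfl⟩ : ∃ δ, m = -δ := ⟨-m, by simp⟩
  have hδ : 0 < δ := by linarith [hm.2]
  have hsub : Ioo (-δ) 0 ⊆ Ioo (-δ₁) 0 := Ioo_subset_Ioo_left hm.1.le
  have hR : RadialTime n T R δ := hR₁.mono hδ (by linarith [hm.1])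
  have hw := hw₁.mono hsub
  have hVc := hV₁.mono hsub
  have hWc : ContinuousOn W (Ioo (-δ) 0) := continuousOn_futureInf hw hwt
  have haW' : ∀ t ∈ Ioo (-δ) 0, a < W t := fun t ht => haW t ⟨ht.1.le, ht.2⟩
  have hρc : ContinuousOn (fun t => R t ^ (2 * n)) (Ioo (-δ) 0) := hR.continuousOn_inv.pow _
  have hρ0 : ∀ t ∈ Ioo (-δ) 0, 0 ≤ R t ^ (2 * n) := fun t ht => (pow_pos (hR.inv_pos ht) _).le
  have hbound : ∀ t ∈ Ioo (-δ) 0, ∀ x, ‖x‖ = R t →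
      u₁ x ∈ Icc (W t) (V t) ∧ u₂ x ∈ Icc (W t) (V t) := by
    intro t ht x hx
    have hxr : ‖x‖ ∈ Ioo 0 1 := by rw [hx]; exact ⟨hR.inv_pos ht, (hR.mem t ht).2⟩
    have h3 := le_sphereMax hU hxr
    have h4 := le_sphereMax hZ hxr
    have h5 : W t ≤ w t := futureInf_le hw hwt ht ⟨le_rfl, ht.2⟩
    rw [hx] at h3 h4
    have h6 : w t ≤ -Z x := by simp only [hwdef]; linarith
    have h7 : -u₁ x ≤ Z x := le_max_left _ _
    have h8 : -u₂ x ≤ Z x := le_max_right _ _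
    exact ⟨⟨by linarith, (le_max_left _ _).trans h3⟩, ⟨by linarith, (le_max_right _ _).trans h3⟩⟩
  have hWV : ∀ t ∈ Ioo (-δ) 0, W t ≤ V t := by
    intro t ht
    obtain ⟨x, hx, -⟩ := exists_eq_sphereMax hU ⟨hR.inv_pos ht, (hR.mem t ht).2⟩
    have := (hbound t ht x hx).1
    exact this.1.trans this.2
  obtain ⟨p, hp⟩ := exists_subPrim_of_viscositySub (V := V)
    (α := fun t => R t ^ (2 * n) * f (V t)) hVc (hρc.mul (hf.comp_continuousOn hVc))
    fun t ht => viscositySub_sphereMax hR h₁.1 h₂.1 h₁.2.1 h₂.2.1 ht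
  have hviscW : ∀ t ∈ Ioo (-δ) 0, ViscositySub (fun t => -w t)
      (fun t => -(R t ^ (2 * n) * f (w t))) t := by
    intro t ht
    have := viscositySub_sphereMax (g := fun s => -f (-s)) hR h₁.1.neg h₂.1.neg
      (fun x hx => (lapl_neg u₁ x).trans (by simp [h₁.2.1 x hx]))
      (fun x hx => (lapl_neg u₂ x).trans (by simp [h₂.2.1 x hx])) ht
    simpa [hwdef] using this
  obtain ⟨q, hq⟩ := exists_subPrim_of_viscositySub (V := fun t => -W t)
    (α := fun t => -(R t ^ (2 * n) * f (W t))) hWc.neg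
    (hρc.mul (hf.comp_continuousOn hWc)).neg
    fun t ht => viscositySub_neg_futureInf hw hwt hviscW ht
      (mul_nonneg (hρ0 t ht) (hfpos _ (haW' t ht)))
  obtain ⟨t₀, ht₀, M, C, hMC⟩ := exists_integral_sub_le (q := fun t => -q t)
    (ρ := fun t => R t ^ (2 * n)) (L := 2 * n * 4 ^ n) hδ hp
    (by simpa using hq) hρc hρ0 (fun t ht => pow_le_one₀ (hR.inv_pos ht).le (hR.mem t ht).2.le)
    (by
      have := (hR.tendsto_inv.mono_right nhdsWithin_le_nhds).pow (2 * n)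
      rwa [one_pow] at this)
    (by positivity) (fun x hx y hy hxy => hR.weight_le hx hy hxy) hf hF ha hfpos hKO hK0 hfK
    (monotoneOn_futureInf hw hwt) haW' hWV hWt
  have hM0 : 0 ≤ M := by linarith [hWV t₀ ht₀, (hMC t₀ ⟨le_rfl, ht₀.2⟩).1]
  have hR0 : 0 < R t₀ := hR.inv_pos ht₀
  have hR1 : R t₀ < 1 := (hR.mem t₀ ht₀).2
  obtain ⟨B, hB⟩ : ∃ B, ∀ x ∈ closedBall (0 : EuclideanSpace ℝ (Fin (n + 1))) (R t₀),
      |f (u₁ x) - f (u₂ x)| ≤ B := by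
    have hs := closedBall_subset_ball (x := (0 : EuclideanSpace ℝ (Fin (n + 1)))) hR1
    exact (isCompact_closedBall _ _).exists_bound_of_continuousOn
      ((hf.comp_continuousOn (hc₁.mono hs)).sub (hf.comp_continuousOn (hc₂.mono hs)))
  refine ⟨max (B * R t₀ + 2 ^ n * (C + 2 * k * M * (-t₀))) 1, by positivity, fun θ hθ => ?_⟩
  have hnorm : ∀ r, 0 ≤ r → ‖r • θ‖ = r := fun r hr => by
    rw [norm_smul, hθ, mul_one, Real.norm_of_nonneg hr]
  have hg : ContinuousOn (fun r : ℝ => |f (u₁ (r • θ)) - f (u₂ (r • θ))|) (Ico 0 1) := by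
    have hm : MapsTo (fun r : ℝ => r • θ) (Ico 0 1) (ball 0 1) := fun r hr => by
      rw [mem_ball_zero_iff, hnorm r hr.1]
      exact hr.2
    have hl : ContinuousOn (fun r : ℝ => r • θ) (Ico 0 1) := by fun_prop
    exact ((hf.comp_continuousOn (hc₁.comp hl hm)).sub (hf.comp_continuousOn (hc₂.comp hl hm))).abs
  have hint : ∀ x ∈ Ico (0:ℝ) 1, ∀ y ∈ Ico (0:ℝ) 1,
      IntervalIntegrable (fun r : ℝ => |f (u₁ (r • θ)) - f (u₂ (r • θ))|) volume x y :=
    fun x hx y hy => (hg.mono (ordConnected_Ico.uIcc_subset hx hy)).intervalIntegrable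
  refine integral_zero_one_le hR1 (by positivity) fun r hr => le_max_of_le_left ?_
  have h0m : (0:ℝ) ∈ Ico (0:ℝ) 1 := ⟨le_rfl, one_pos⟩
  have hRm : R t₀ ∈ Ico (0:ℝ) 1 := ⟨hR0.le, hR1⟩
  have hrm : r ∈ Ico (0:ℝ) 1 := ⟨hR0.le.trans hr.1, hr.2⟩
  rw [← intervalIntegral.integral_add_adjacent_intervals (hint 0 h0m _ hRm) (hint _ hRm r hrm)]
  refine add_le_add ?_ ?_
  · have := intervalIntegral.integral_mono_on hR0.le (hint 0 h0m _ hRm)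
      (intervalIntegrable_const (c := B)) fun s hs => hB (s • θ)
        (by rw [mem_closedBall_zero_iff, hnorm s hs.1]; exact hs.2)
    rw [intervalIntegral.integral_const, smul_eq_mul] at this
    linarith
  · have ht := hR.mem_of_le ht₀ hr.1 hr.2
    have hRT : R (T r) = r := hR.left_inv (hR0.trans_le hr.1) ⟨ht₀.1.trans_le ht.1, ht.2⟩
    have := hR.integral_le (g := fun r : ℝ => |f (u₁ (r • θ)) - f (u₂ (r • θ))|) ht₀ ht hVc hWc
      hf hg (fun _ _ => abs_nonneg _) hK0 hM0 (fun s hs => by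
        have hs' : s ∈ Ico t₀ 0 := ⟨hs.1, hs.2.trans_lt ht.2⟩
        have hsI : s ∈ Ioo (-δ) 0 := ⟨ht₀.1.trans_le hs.1, hs'.2⟩
        have hb := hbound s hsI (R s • θ) (hnorm _ (hR.inv_pos hsI).le)
        exact abs_sub_le_of_mem_Icc hK0 hfK hb.1 hb.2 (hMC s hs').1) (hMC (T r) ht).2
    rwa [hRT] at this
end
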